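/- Let X be an irreducible plane quartic whose singular locus consists of exactly one ordinary node and no other singular points. Then X has exactly 16 theta-lines of type 0 (bitangents) and exactly 6 theta-lines of type 1 (lines through the node which are tangent to X at a smooth point), and no theta-lines of type 2. -/

import Mathlib

open MvPolynomial

noncomputable section

abbrev P2 : Type := Projectivization ℂ (Fin 3 → ℂ)

/-- The zero locus in `ℙ²` of a polynomial `F`: the points all of whose
representative vectors are zeros of `F`. -/
def curve (F : MvPolynomial (Fin 3) ℂ) : Set P2 :=
  {p | ∀ (w : Fin 3 → ℂ) (hw : w ≠ 0), Projectivization.mk ℂ w hw = p → eval w F = 0}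

/-- The projective line spanned by two vectors. -/
def lineThrough (u v : Fin 3 → ℂ) : Set P2 :=
  {p | ∃ s t : ℂ, ∃ h : s • u + t • v ≠ 0, p = Projectivization.mk ℂ (s • u + t • v) h}

/-- A subset of `ℙ²` is a line if it is the projective span of two
linearly independent vectors. -/
def IsLine (S : Set P2) : Prop :=
  ∃ u v : Fin 3 → ℂ, LinearIndependent ℂ ![u, v] ∧ S = lineThrough u v

/-- The restriction of `F` to the affine parametrization `t ↦ a + t • b` of the line
through `[a]` and `[b]`, as a polynomial in `t`. -/
def lineRest (F : MvPolynomial (Fin 3) ℂ) (a b : Fin 3 → ℂ) : Polynomial ℂ :=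
  eval₂ Polynomial.C (fun i => Polynomial.C (a i) + Polynomial.X * Polynomial.C (b i)) F

/-- The local intersection multiplicity, at the point `[a]`, of the curve `F = 0` with the
line through `[a]` and `[b]` (parametrized by `t ↦ a + t • b`, the point `[a]`
corresponding to `t = 0`). -/
def multAt (F : MvPolynomial (Fin 3) ℂ) (a b : Fin 3 → ℂ) : ℕ :=
  Polynomial.rootMultiplicity 0 (lineRest F a b)

/-- The scheme `X ∩ L` (for `X = {F = 0}`, `L` a line) is everywhere nonreduced: at each
point of `X ∩ L` the local intersection multiplicity is at least `2`.  (Stated over all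
parametrizations of `L`; the base point `a` of a parametrization is a point of `L`, and
every point of `L` occurs as such a base point.) -/
def EverywhereTangent (F : MvPolynomial (Fin 3) ℂ) (S : Set P2) : Prop :=
  ∀ a b : Fin 3 → ℂ, LinearIndependent ℂ ![a, b] → S = lineThrough a b →
    ∀ ha : a ≠ 0, Projectivization.mk ℂ a ha ∈ curve F → 2 ≤ multAt F a b

/-- A theta-line of the quartic `F`: either contained in the curve, or intersecting it
everywhere nonreducedly. -/
def ThetaLine (F : MvPolynomial (Fin 3) ℂ) (S : Set P2) : Prop :=
  IsLine S ∧ (S ⊆ curve F ∨ EverywhereTangent F S)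

/-- A bitangent line of (a smooth curve) `F = 0`: a line, not contained in the curve,
whose scheme-theoretic intersection with the curve is everywhere nonreduced. -/
def Bitangent (F : MvPolynomial (Fin 3) ℂ) (S : Set P2) : Prop :=
  IsLine S ∧ ¬ S ⊆ curve F ∧ EverywhereTangent F S

/-- The line `S` is tangent to the curve `F = 0` at the point `q`: the local intersection
multiplicity there is at least `2`. -/
def TangentAt (F : MvPolynomial (Fin 3) ℂ) (S : Set P2) (q : P2) : Prop :=
  IsLine S ∧ q ∈ S ∧ q ∈ curve F ∧
    ∀ a b : Fin 3 → ℂ, LinearIndependent ℂ ![a, b] → S = lineThrough a b →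
      ∀ ha : a ≠ 0, Projectivization.mk ℂ a ha = q → 2 ≤ multAt F a b

/-- The curve `F = 0` is smooth: `F` and its partial derivatives have no common
projective zero. -/
def SmoothCurve (F : MvPolynomial (Fin 3) ℂ) : Prop :=
  ∀ w : Fin 3 → ℂ, w ≠ 0 → ¬ (eval w F = 0 ∧ ∀ i : Fin 3, eval w (pderiv i F) = 0)

/-- Iterated partial derivative along a list of coordinate directions. -/
def pderivList (l : List (Fin 3)) (F : MvPolynomial (Fin 3) ℂ) : MvPolynomial (Fin 3) ℂ :=
  l.foldr (fun i G => pderiv i G) F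

/-- `F` vanishes to order at least `m` at the point `p` (all partial derivatives of
order `< m` vanish at `p`); i.e. `p` is a point of multiplicity at least `m` of `F = 0`. -/
def VanishesToOrder (F : MvPolynomial (Fin 3) ℂ) (p : P2) (m : ℕ) : Prop :=
  ∀ l : List (Fin 3), l.length < m →
    ∀ (w : Fin 3 → ℂ) (hw : w ≠ 0), Projectivization.mk ℂ w hw = p →
      eval w (pderivList l F) = 0

/-- `p` is a singular point of the curve `F = 0`. -/
def IsSingularAt (F : MvPolynomial (Fin 3) ℂ) (p : P2) : Prop :=
  VanishesToOrder F p 2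

/-- `p` is a double point: a point of multiplicity exactly `2`. -/
def IsDoublePoint (F : MvPolynomial (Fin 3) ℂ) (p : P2) : Prop :=
  VanishesToOrder F p 2 ∧ ¬ VanishesToOrder F p 3

/-- The quadratic form (in the direction `b`) cutting out the tangent cone of `F = 0`
at the double point `[a]`: the degree-`2` Taylor coefficient of `t ↦ F (a + t • b)`. -/
def coneCoeff (F : MvPolynomial (Fin 3) ℂ) (a b : Fin 3 → ℂ) : ℂ :=
  (lineRest F a b).coeff 2

/-- `p` is an ordinary node: a double point whose tangent cone consists of two distinct
lines, i.e. the tangent-cone quadratic has two null directions independent modulo `a`. -/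
def OrdinaryNode (F : MvPolynomial (Fin 3) ℂ) (p : P2) : Prop :=
  IsDoublePoint F p ∧
    ∀ (a : Fin 3 → ℂ) (ha : a ≠ 0), Projectivization.mk ℂ a ha = p →
      ∃ b₁ b₂ : Fin 3 → ℂ, LinearIndependent ℂ ![a, b₁, b₂] ∧
        coneCoeff F a b₁ = 0 ∧ coneCoeff F a b₂ = 0

/-- At the double point `[a]`, the tangent cone is the double line through `[a]` and
`[b₀]`: `b₀` is a null direction of the tangent-cone quadratic, and every null
direction lies on the line spanned by `a` and `b₀`. -/
def DoubleLineCone (F : MvPolynomial (Fin 3) ℂ) (a b₀ : Fin 3 → ℂ) : Prop :=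
  LinearIndependent ℂ ![a, b₀] ∧ coneCoeff F a b₀ = 0 ∧
    ∀ b : Fin 3 → ℂ, coneCoeff F a b = 0 → b ∈ Submodule.span ℂ ({a, b₀} : Set (Fin 3 → ℂ))

/-- `p` is an ordinary cusp: a double point whose tangent cone is a double line `L₀`
with local intersection multiplicity `i(L₀ · X) = 3` at `p`. -/
def OrdinaryCusp (F : MvPolynomial (Fin 3) ℂ) (p : P2) : Prop :=
  IsDoublePoint F p ∧
    ∀ (a : Fin 3 → ℂ) (ha : a ≠ 0), Projectivization.mk ℂ a ha = p →
      ∃ b₀ : Fin 3 → ℂ, DoubleLineCone F a b₀ ∧ multAt F a b₀ = 3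

/-- `p` is an ordinary tacnode: a double point whose tangent cone is a double line `L₀`
with local intersection multiplicity `i(L₀ · X) = 4` at `p`. -/
def OrdinaryTacnode (F : MvPolynomial (Fin 3) ℂ) (p : P2) : Prop :=
  IsDoublePoint F p ∧
    ∀ (a : Fin 3 → ℂ) (ha : a ≠ 0), Projectivization.mk ℂ a ha = p →
      ∃ b₀ : Fin 3 → ℂ, DoubleLineCone F a b₀ ∧ multAt F a b₀ = 4

/-- A theta-line of type `i`: a theta-line, not a component of the curve, containing
exactly `i` singular points of the curve. -/
def ThetaLineOfType (F : MvPolynomial (Fin 3) ℂ) (i : ℕ) (S : Set P2) : Prop :=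
  ThetaLine F S ∧ ¬ S ⊆ curve F ∧ {p | p ∈ S ∧ IsSingularAt F p}.ncard = i

/-- Three points of `ℙ²` are collinear. -/
def Collin (p q r : P2) : Prop :=
  ∃ S : Set P2, IsLine S ∧ p ∈ S ∧ q ∈ S ∧ r ∈ S


/-- An ordinary bitangent: a bitangent meeting the curve at exactly two distinct points,
each with local intersection multiplicity exactly `2`. -/
def OrdinaryBitangent (F : MvPolynomial (Fin 3) ℂ) (S : Set P2) : Prop :=
  Bitangent F S ∧ (S ∩ curve F).ncard = 2 ∧
    ∀ a b : Fin 3 → ℂ, LinearIndependent ℂ ![a, b] → S = lineThrough a b →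
      ∀ ha : a ≠ 0, Projectivization.mk ℂ a ha ∈ curve F → multAt F a b = 2

/-- A bitangent meeting the curve only at smooth points. -/
def SmoothBitangent (F : MvPolynomial (Fin 3) ℂ) (S : Set P2) : Prop :=
  Bitangent F S ∧ ∀ p ∈ S ∩ curve F, ¬ IsSingularAt F p

/-! ### Restriction of a form to a parametrized line -/

lemma lineRest_eval (F : MvPolynomial (Fin 3) ℂ) (a b : Fin 3 → ℂ) (t : ℂ) :
    (lineRest F a b).eval t = eval (a + t • b) F := by
  unfold lineRest
  induction F using MvPolynomial.induction_on with
  | C r => simp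
  | add p q hp hq => rw [eval₂_add, Polynomial.eval_add, hp, hq, map_add]
  | mul_X p i hp => rw [eval₂_mul, Polynomial.eval_mul, hp, map_mul, eval₂_X]; simp [mul_comm t]

lemma derivative_lineRest (F : MvPolynomial (Fin 3) ℂ) (a b : Fin 3 → ℂ) :
    Polynomial.derivative (lineRest F a b) =
      ∑ i, Polynomial.C (b i) * lineRest (pderiv i F) a b := by
  unfold lineRest
  induction F using MvPolynomial.induction_on with
  | C r => simp
  | add p q hp hq =>
    simp only [eval₂_add, map_add, hp, hq, mul_add,
      Finset.sum_add_distrib]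
  | mul_X p i hp =>
    simp only [eval₂_mul, eval₂_X, Polynomial.derivative_mul, hp, Derivation.leibniz,
      Polynomial.derivative_add, Polynomial.derivative_C, Polynomial.derivative_X, pderiv_X,
      smul_eq_mul, eval₂_add]
    fin_cases i <;> simp [Fin.sum_univ_three, Pi.single_apply] <;> ring

lemma lineRest_coeff_zero (F : MvPolynomial (Fin 3) ℂ) (a b : Fin 3 → ℂ) :
    (lineRest F a b).coeff 0 = eval a F := by
  rw [Polynomial.coeff_zero_eq_eval_zero, lineRest_eval]
  simp

lemma lineRest_coeff_one (F : MvPolynomial (Fin 3) ℂ) (a b : Fin 3 → ℂ) :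
    (lineRest F a b).coeff 1 = ∑ i, b i * eval a (pderiv i F) := by
  have h := congrArg (fun P => Polynomial.coeff P 0) (derivative_lineRest F a b)
  simp only [Polynomial.coeff_derivative, Polynomial.finsetSum_coeff, Polynomial.coeff_C_mul,
    lineRest_coeff_zero] at h
  simpa using h

lemma lineRest_coeff_two (F : MvPolynomial (Fin 3) ℂ) (a b : Fin 3 → ℂ) :
    (lineRest F a b).coeff 2 * 2 =
      ∑ i, b i * ∑ j, b j * eval a (pderiv j (pderiv i F)) := by
  have h := congrArg (fun P => Polynomial.coeff P 1) (derivative_lineRest F a b)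
  simp only [Polynomial.coeff_derivative, Polynomial.finsetSum_coeff, Polynomial.coeff_C_mul,
    lineRest_coeff_one] at h
  rw [← h]
  norm_num

lemma eval_smul_of_isHomogeneous {F : MvPolynomial (Fin 3) ℂ} {n : ℕ} (hF : F.IsHomogeneous n)
    (c : ℂ) (w : Fin 3 → ℂ) : eval (c • w) F = c ^ n * eval w F := by
  rw [eval_eq, eval_eq, Finset.mul_sum]
  refine Finset.sum_congr rfl fun d hd => ?_
  have hd' : ∑ i ∈ d.support, d i = n := (hF.degree_eq_sum_deg_support hd).symm
  simp only [Pi.smul_apply, smul_eq_mul, mul_pow, Finset.prod_mul_distrib]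
  rw [Finset.prod_pow_eq_pow_sum, hd']
  ring

lemma pderiv_pderiv_comm (i j : Fin 3) (F : MvPolynomial (Fin 3) ℂ) :
    pderiv i (pderiv j F) = pderiv j (pderiv i F) := by
  induction F using MvPolynomial.induction_on with
  | C r => simp
  | add p q hp hq => simp [hp, hq]
  | mul_X p k hp =>
    have h (a b : Fin 3) : pderiv a (Pi.single (M := fun _ => MvPolynomial (Fin 3) ℂ) b 1 k) = 0 := by
      by_cases hk : k = b
      · subst hk; simp
      · simp [Pi.single_eq_of_ne hk]
    simp only [Derivation.leibniz, smul_eq_mul, map_add, pderiv_X, hp]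
    simp only [h]
    ring

/-- Every form of positive degree is a combination of the coordinates with coefficients forms of
one degree less. -/
lemma exists_eval_eq_sum {F : MvPolynomial (Fin 3) ℂ} {n : ℕ} (hF : F.IsHomogeneous (n + 1)) :
    ∃ G : Fin 3 → MvPolynomial (Fin 3) ℂ, (∀ i, (G i).IsHomogeneous n) ∧
      ∀ w, eval w F = ∑ i, w i * eval w (G i) := by
  refine ⟨fun i => C ((n + 1 : ℂ)⁻¹) * pderiv i F, fun i => (hF.pderiv).C_mul _, fun w => ?_⟩
  have h := congrArg (eval w) hF.sum_X_mul_pderiv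
  simp only [map_sum, map_mul, eval_X, nsmul_eq_mul] at h
  have h0 : (n + 1 : ℂ) ≠ 0 := by exact_mod_cast n.succ_ne_zero
  simp only [map_mul, eval_C]
  rw [← mul_right_inj' h0]
  rw [map_natCast] at h
  push_cast at h
  rw [← h, Finset.mul_sum]
  refine Finset.sum_congr rfl fun i _ => ?_
  field_simp

lemma exists_quartic_coeffs {F : MvPolynomial (Fin 3) ℂ} (hF : F.IsHomogeneous 4) :
    ∃ c : Fin 3 → Fin 3 → Fin 3 → Fin 3 → ℂ, ∀ w,
      eval w F = ∑ i, w i * ∑ j, w j * ∑ k, w k * ∑ l, w l * c i j k l := by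
  obtain ⟨G, hG, h1⟩ := exists_eval_eq_sum hF
  choose G2 hG2 h2 using fun i => exists_eval_eq_sum (hG i)
  choose G3 hG3 h3 using fun i j => exists_eval_eq_sum (hG2 i j)
  choose G4 hG4 h4 using fun i j k => exists_eval_eq_sum (hG3 i j k)
  refine ⟨fun i j k l => coeff 0 (G4 i j k l), fun w => ?_⟩
  have h5 : ∀ i j k l, eval w (G4 i j k l) = coeff 0 (G4 i j k l) := by
    intro i j k l
    have := totalDegree_eq_zero_iff_eq_C.1 (Nat.le_zero.1 (hG4 i j k l).totalDegree_le)
    conv_lhs => rw [this]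
    simp
  simp only [h1, h2, h3, h4, h5]

/-- A quartic form in coordinates: fifteen coefficients. -/
lemma exists_coords_form {F : MvPolynomial (Fin 3) ℂ} (hF : F.IsHomogeneous 4)
    (a b₁ b₂ : Fin 3 → ℂ) :
    ∃ k : Fin 15 → ℂ, ∀ z x y : ℂ, eval (z • a + x • b₁ + y • b₂) F =
      k 0 * z ^ 4 + (k 1 * x + k 2 * y) * z ^ 3 + (k 3 * x ^ 2 + k 4 * x * y + k 5 * y ^ 2) * z ^ 2
      + (k 6 * x ^ 3 + k 7 * x ^ 2 * y + k 8 * x * y ^ 2 + k 9 * y ^ 3) * z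
      + (k 10 * x ^ 4 + k 11 * x ^ 3 * y + k 12 * x ^ 2 * y ^ 2 + k 13 * x * y ^ 3
        + k 14 * y ^ 4) := by
  let G : MvPolynomial (Fin 3) ℂ :=
    aeval (fun i => C (a i) * X 0 + C (b₁ i) * X 1 + C (b₂ i) * X 2) F
  have hG : G.IsHomogeneous 4 := by
    refine hF.aeval (n := 1) _ fun i => ?_
    exact ((isHomogeneous_C_mul_X _ _).add (isHomogeneous_C_mul_X _ _)).add
      (isHomogeneous_C_mul_X _ _)
  have hGe : ∀ z x y : ℂ, eval ![z, x, y] G = eval (z • a + x • b₁ + y • b₂) F := by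
    intro z x y
    have : ∀ H : MvPolynomial (Fin 3) ℂ, eval ![z, x, y]
        (aeval (fun i => C (a i) * X 0 + C (b₁ i) * X 1 + C (b₂ i) * X 2) H) =
        eval (z • a + x • b₁ + y • b₂) H := by
      intro H
      induction H using MvPolynomial.induction_on with
      | C r => simp
      | add p q hp hq => rw [map_add, map_add, hp, hq, map_add]
      | mul_X p i hp =>
        simp only [map_mul, hp]
        simp
        left; ring
    exact this F
  obtain ⟨c, hc⟩ := exists_quartic_coeffs hG
  let S2 (i j : Fin 3) : ℂ := c i i i j + c i i j i + c i j i i + c j i i i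
  let S22 (i j : Fin 3) : ℂ :=
    c i i j j + c i j i j + c i j j i + c j i i j + c j i j i + c j j i i
  let S211 (i j k : Fin 3) : ℂ :=
    c i i j k + c i i k j + c i j i k + c i j k i + c i k i j + c i k j i
    + c j i i k + c j i k i + c j k i i + c k i i j + c k i j i + c k j i i
  refine ⟨![c 0 0 0 0, S2 0 1, S2 0 2, S22 0 1, S211 0 1 2, S22 0 2, S2 1 0, S211 1 0 2,
    S211 2 0 1, S2 2 0, c 1 1 1 1, S2 1 2, S22 1 2, S2 2 1, c 2 2 2 2], fun z x y => ?_⟩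
  rw [← hGe, hc]
  simp only [Fin.sum_univ_three, S2, S22, S211]
  simp only [Matrix.cons_val]
  ring

/-! ### Singular points and the local form at an ordinary node -/

lemma mk_eq_iff_smul {w w' : Fin 3 → ℂ} (hw : w ≠ 0) (hw' : w' ≠ 0) :
    Projectivization.mk ℂ w' hw' = Projectivization.mk ℂ w hw ↔ ∃ c : ℂ, w' = c • w := by
  rw [Projectivization.mk_eq_mk_iff']
  exact ⟨fun ⟨c, h⟩ => ⟨c, h.symm⟩, fun ⟨c, h⟩ => ⟨c, h.symm⟩⟩

lemma mem_curve_mk_iff {F : MvPolynomial (Fin 3) ℂ} {n : ℕ} (hF : F.IsHomogeneous n)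
    {w : Fin 3 → ℂ} (hw : w ≠ 0) : Projectivization.mk ℂ w hw ∈ curve F ↔ eval w F = 0 := by
  refine ⟨fun h => h w hw rfl, fun h w' hw' e => ?_⟩
  obtain ⟨c, rfl⟩ := (mk_eq_iff_smul hw hw').1 e
  rw [eval_smul_of_isHomogeneous hF, h, mul_zero]

lemma isSingularAt_mk {F : MvPolynomial (Fin 3) ℂ} {n : ℕ} (hF : F.IsHomogeneous n)
    {w : Fin 3 → ℂ} (hw : w ≠ 0) (h : ∀ v, (Polynomial.X : Polynomial ℂ) ^ 2 ∣ lineRest F w v) :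
    IsSingularAt F (Projectivization.mk ℂ w hw) := by
  have h0 : eval w F = 0 := by
    rw [← lineRest_coeff_zero F w 0]
    exact (Polynomial.X_pow_dvd_iff.1 (h 0)) 0 (by norm_num)
  have h1 : ∀ i, eval w (pderiv i F) = 0 := by
    intro i
    have := (Polynomial.X_pow_dvd_iff.1 (h (Pi.single i 1))) 1 (by norm_num)
    rw [lineRest_coeff_one] at this
    simpa [Pi.single_apply] using this
  intro l hl w' hw' e
  obtain ⟨c, rfl⟩ := (mk_eq_iff_smul hw hw').1 e
  match l, hl with
  | [], _ => simp [pderivList, eval_smul_of_isHomogeneous hF, h0]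
  | [i], _ => simp [pderivList, eval_smul_of_isHomogeneous hF.pderiv, h1]

lemma vanishesToOrder_three_mk {F : MvPolynomial (Fin 3) ℂ} {n : ℕ} (hF : F.IsHomogeneous n)
    {w : Fin 3 → ℂ} (hw : w ≠ 0) (h : ∀ v, (Polynomial.X : Polynomial ℂ) ^ 3 ∣ lineRest F w v) :
    VanishesToOrder F (Projectivization.mk ℂ w hw) 3 := by
  have hs := isSingularAt_mk hF hw fun v => (pow_dvd_pow _ (by norm_num)).trans (h v)
  have h2 : ∀ i j, eval w (pderiv i (pderiv j F)) = 0 := by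
    have key : ∀ v : Fin 3 → ℂ,
        ∑ i, v i * ∑ j, v j * eval w (pderiv j (pderiv i F)) = 0 := by
      intro v
      rw [← lineRest_coeff_two, (Polynomial.X_pow_dvd_iff.1 (h v)) 2 (by norm_num), zero_mul]
    have hd : ∀ i, eval w (pderiv i (pderiv i F)) = 0 := by
      intro i
      simpa [Pi.single_apply] using key (Pi.single i 1)
    intro i j
    have hij := key (Pi.single i 1 + Pi.single j 1)
    simp only [Pi.add_apply, add_mul, mul_add, Finset.sum_add_distrib] at hij
    simp only [Pi.single_apply, ite_mul, one_mul, zero_mul, Finset.sum_ite_eq',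
      Finset.mem_univ, if_true, hd] at hij
    rw [pderiv_pderiv_comm j i] at hij
    linear_combination hij / 2
  intro l hl w' hw' e
  by_cases hl2 : l.length < 2
  · exact hs l hl2 w' hw' e
  obtain ⟨c, rfl⟩ := (mk_eq_iff_smul hw hw').1 e
  match l, hl, hl2 with
  | [i, j], _, _ => simp [pderivList, eval_smul_of_isHomogeneous hF.pderiv.pderiv, h2]
  | [], _, h => simp at h
  | [_], _, h => simp at h

lemma exists_eq_smul_add {a b₁ b₂ : Fin 3 → ℂ} (h : LinearIndependent ℂ ![a, b₁, b₂])
    (w : Fin 3 → ℂ) : ∃ z x y : ℂ, w = z • a + x • b₁ + y • b₂ := by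
  have hs := h.span_eq_top_of_card_eq_finrank (by simp)
  have hw : w ∈ Submodule.span ℂ (Set.range ![a, b₁, b₂]) := by rw [hs]; trivial
  obtain ⟨c, hc⟩ := (Submodule.mem_span_range_iff_exists_fun ℂ).1 hw
  refine ⟨c 0, c 1, c 2, ?_⟩
  rw [← hc, Fin.sum_univ_three]
  simp

lemma eq_zero_of_smul_add_eq_zero {a b₁ b₂ : Fin 3 → ℂ} (h : LinearIndependent ℂ ![a, b₁, b₂])
    {z x y : ℂ} (e : z • a + x • b₁ + y • b₂ = 0) : z = 0 ∧ x = 0 ∧ y = 0 := by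
  have := Fintype.linearIndependent_iff.1 h ![z, x, y] (by simpa [Fin.sum_univ_three] using e)
  exact ⟨this 0, this 1, this 2⟩

/-- The univariate polynomial `c₀ + c₁ X + c₂ X² + c₃ X³ + c₄ X⁴`. -/
def quarticPoly (c₀ c₁ c₂ c₃ c₄ : ℂ) : Polynomial ℂ :=
  Polynomial.C c₀ + Polynomial.C c₁ * Polynomial.X + Polynomial.C c₂ * Polynomial.X ^ 2
    + Polynomial.C c₃ * Polynomial.X ^ 3 + Polynomial.C c₄ * Polynomial.X ^ 4

lemma quarticPoly_coeff (c₀ c₁ c₂ c₃ c₄ : ℂ) (n : ℕ) :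
    (quarticPoly c₀ c₁ c₂ c₃ c₄).coeff n =
      (if n = 0 then c₀ else 0) + (if n = 1 then c₁ else 0) + (if n = 2 then c₂ else 0)
        + (if n = 3 then c₃ else 0) + (if n = 4 then c₄ else 0) := by
  simp [quarticPoly, Polynomial.coeff_C, Polynomial.coeff_X, Polynomial.coeff_X_pow, eq_comm]

lemma quarticPoly_eval (c₀ c₁ c₂ c₃ c₄ t : ℂ) :
    (quarticPoly c₀ c₁ c₂ c₃ c₄).eval t = c₀ + c₁ * t + c₂ * t ^ 2 + c₃ * t ^ 3 + c₄ * t ^ 4 := by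
  simp [quarticPoly]

/-- The quartic `x y z² + 2 q(x, y) z + r(x, y)` with a node at `x = y = 0`, where `q` and `r` are
the binary forms with coefficients `d` and `e`. -/
def nodalForm (d : Fin 4 → ℂ) (e : Fin 5 → ℂ) (z x y : ℂ) : ℂ :=
  x * y * z ^ 2 + 2 * (d 0 * x ^ 3 + d 1 * x ^ 2 * y + d 2 * x * y ^ 2 + d 3 * y ^ 3) * z
    + (e 0 * x ^ 4 + e 1 * x ^ 3 * y + e 2 * x ^ 2 * y ^ 2 + e 3 * x * y ^ 3 + e 4 * y ^ 4)

lemma exists_nodalForm {F : MvPolynomial (Fin 3) ℂ} (hF : F.IsHomogeneous 4) {p : P2}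
    (hp : OrdinaryNode F p) :
    ∃ (a b₁ b₂ : Fin 3 → ℂ) (ha : a ≠ 0) (d : Fin 4 → ℂ) (e : Fin 5 → ℂ),
      p = Projectivization.mk ℂ a ha ∧ LinearIndependent ℂ ![a, b₁, b₂] ∧
      ∀ z x y : ℂ, eval (z • a + x • b₁ + y • b₂) F = nodalForm d e z x y := by
  obtain ⟨a, ha, rfl⟩ : ∃ (a : Fin 3 → ℂ) (ha : a ≠ 0), p = Projectivization.mk ℂ a ha :=
    ⟨p.rep, p.rep_nonzero, p.mk_rep.symm⟩
  obtain ⟨⟨hsing, hdbl⟩, hcone⟩ := hp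
  obtain ⟨b₁, b₂, hli, hc1, hc2⟩ := hcone a ha rfl
  obtain ⟨k, hk⟩ := exists_coords_form hF a b₁ b₂
  have hpoly : ∀ z x y : ℂ, lineRest F a (z • a + x • b₁ + y • b₂) =
      Polynomial.C (k 0) * (1 + Polynomial.C z * Polynomial.X) ^ 4
      + Polynomial.C (k 1 * x + k 2 * y) * (1 + Polynomial.C z * Polynomial.X) ^ 3 * Polynomial.X
      + Polynomial.C (k 3 * x ^ 2 + k 4 * x * y + k 5 * y ^ 2)
        * (1 + Polynomial.C z * Polynomial.X) ^ 2 * Polynomial.X ^ 2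
      + Polynomial.C (k 6 * x ^ 3 + k 7 * x ^ 2 * y + k 8 * x * y ^ 2 + k 9 * y ^ 3)
        * (1 + Polynomial.C z * Polynomial.X) * Polynomial.X ^ 3
      + Polynomial.C (k 10 * x ^ 4 + k 11 * x ^ 3 * y + k 12 * x ^ 2 * y ^ 2 + k 13 * x * y ^ 3
        + k 14 * y ^ 4) * Polynomial.X ^ 4 := by
    intro z x y
    refine Polynomial.funext fun t => ?_
    rw [lineRest_eval, show a + t • (z • a + x • b₁ + y • b₂) =
      (1 + z * t) • a + (x * t) • b₁ + (y * t) • b₂ by module, hk]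
    simp only [Polynomial.eval_add, Polynomial.eval_mul, Polynomial.eval_C, Polynomial.eval_pow,
      Polynomial.eval_X, Polynomial.eval_one]
    ring
  have hpoly0 : ∀ x y : ℂ, lineRest F a (x • b₁ + y • b₂) =
      quarticPoly (k 0) (k 1 * x + k 2 * y) (k 3 * x ^ 2 + k 4 * x * y + k 5 * y ^ 2)
        (k 6 * x ^ 3 + k 7 * x ^ 2 * y + k 8 * x * y ^ 2 + k 9 * y ^ 3)
        (k 10 * x ^ 4 + k 11 * x ^ 3 * y + k 12 * x ^ 2 * y ^ 2 + k 13 * x * y ^ 3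
          + k 14 * y ^ 4) := by
    intro x y
    simpa [quarticPoly] using hpoly 0 x y
  have hk0 : k 0 = 0 := by
    have := hsing [] (by simp) a ha rfl
    have h2 := hk 1 0 0
    simp only [pderivList, List.foldr_nil] at this
    simpa [this] using h2.symm
  have hq1 : ∀ x y : ℂ, k 1 * x + k 2 * y = 0 := by
    intro x y
    have h1 := lineRest_coeff_one F a (x • b₁ + y • b₂)
    have h2 : ∀ i, eval a (pderiv i F) = 0 := fun i => hsing [i] (by simp) a ha rfl
    rw [hpoly0, quarticPoly_coeff] at h1
    simpa [h2] using h1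
  have hk1 : k 1 = 0 := by simpa using hq1 1 0
  have hk2 : k 2 = 0 := by simpa using hq1 0 1
  have hcone : ∀ x y : ℂ, coneCoeff F a (x • b₁ + y • b₂) =
      k 3 * x ^ 2 + k 4 * x * y + k 5 * y ^ 2 := by
    intro x y
    rw [coneCoeff, hpoly0, quarticPoly_coeff]
    simp
  have hk3 : k 3 = 0 := by simpa [hc1] using (hcone 1 0).symm
  have hk5 : k 5 = 0 := by simpa [hc2] using (hcone 0 1).symm
  have hk4 : k 4 ≠ 0 := by
    intro hk4
    refine hdbl (vanishesToOrder_three_mk hF ha fun v => ?_)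
    obtain ⟨z, x, y, rfl⟩ := exists_eq_smul_add hli v
    rw [hpoly, hk0, hk1, hk2, hk3, hk4, hk5]
    simp only [zero_mul, add_zero, Polynomial.C_0, zero_add]
    exact dvd_add (Dvd.intro_left _ rfl) ((pow_dvd_pow _ (by norm_num)).trans (Dvd.intro_left _ rfl))
  refine ⟨a, (k 4)⁻¹ • b₁, b₂, ha,
    ![k 6 * (k 4)⁻¹ ^ 3 / 2, k 7 * (k 4)⁻¹ ^ 2 / 2, k 8 * (k 4)⁻¹ / 2, k 9 / 2],
    ![k 10 * (k 4)⁻¹ ^ 4, k 11 * (k 4)⁻¹ ^ 3, k 12 * (k 4)⁻¹ ^ 2, k 13 * (k 4)⁻¹, k 14],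
    rfl, ?_, fun z x y => ?_⟩
  · rw [Fintype.linearIndependent_iff]
    intro g hg
    simp only [Fin.sum_univ_three, Matrix.cons_val] at hg
    rw [smul_smul] at hg
    obtain ⟨h0, h1, h2⟩ := eq_zero_of_smul_add_eq_zero hli hg
    have h1' : g 1 = 0 := by simpa [hk4] using h1
    intro i
    fin_cases i <;> assumption
  · rw [smul_smul, hk, hk0, hk1, hk2, hk3, hk5, nodalForm]
    simp only [Matrix.cons_val]
    field_simp
    ring

/-! ### Parametrizations of lines -/

lemma mk_mem_lineThrough {u v w : Fin 3 → ℂ} (hw : w ≠ 0) :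
    Projectivization.mk ℂ w hw ∈ lineThrough u v ↔ ∃ s t : ℂ, w = s • u + t • v := by
  constructor
  · rintro ⟨s, t, h, e⟩
    obtain ⟨c, rfl⟩ := (mk_eq_iff_smul h hw).1 e
    exact ⟨c * s, c * t, by module⟩
  · rintro ⟨s, t, rfl⟩
    exact ⟨s, t, hw, rfl⟩

lemma lineThrough_subset {u v u' v' : Fin 3 → ℂ} {α β γ δ : ℂ} (hu : u' = α • u + β • v)
    (hv : v' = γ • u + δ • v) : lineThrough u' v' ⊆ lineThrough u v := by
  rintro p ⟨s, t, h, rfl⟩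
  rw [mk_mem_lineThrough]
  subst hu hv
  exact ⟨s * α + t * γ, s * β + t * δ, by module⟩

lemma lineThrough_eq {u v u' v' : Fin 3 → ℂ} {α β γ δ : ℂ} (hu : u' = α • u + β • v)
    (hv : v' = γ • u + δ • v) (hdet : α * δ - β * γ ≠ 0) :
    lineThrough u' v' = lineThrough u v := by
  refine (lineThrough_subset hu hv).antisymm ?_
  have key : ∀ w : Fin 3 → ℂ, (α * δ - β * γ)⁻¹ • (α * δ - β * γ) • w = w :=
    fun w => inv_smul_smul₀ hdet w
  refine lineThrough_subset (α := (α * δ - β * γ)⁻¹ * δ) (β := -((α * δ - β * γ)⁻¹ * β))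
    (γ := -((α * δ - β * γ)⁻¹ * γ)) (δ := (α * δ - β * γ)⁻¹ * α) ?_ ?_
  · conv_lhs => rw [← key u]
    subst hu hv
    module
  · conv_lhs => rw [← key v]
    subst hu hv
    module

lemma linearIndependent_pair_iff {u v : Fin 3 → ℂ} :
    LinearIndependent ℂ ![u, v] ↔ ∀ s t : ℂ, s • u + t • v = 0 → s = 0 ∧ t = 0 :=
  LinearIndependent.pair_iff

lemma linearIndependent_pair_of_det {u v u' v' : Fin 3 → ℂ} (h : LinearIndependent ℂ ![u, v])
    {α β γ δ : ℂ} (hu : u' = α • u + β • v) (hv : v' = γ • u + δ • v)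
    (hdet : α * δ - β * γ ≠ 0) : LinearIndependent ℂ ![u', v'] := by
  rw [linearIndependent_pair_iff] at h ⊢
  intro s t hst
  subst hu hv
  obtain ⟨h1, h2⟩ := h (s * α + t * γ) (s * β + t * δ) (by rw [← hst]; module)
  constructor
  · refine (mul_eq_zero.1 (?_ : s * (α * δ - β * γ) = 0)).resolve_right hdet
    linear_combination δ * h1 - γ * h2
  · refine (mul_eq_zero.1 (?_ : t * (α * δ - β * γ) = 0)).resolve_right hdet
    linear_combination α * h2 - β * h1

/-! ### Everywhere tangent lines and squares -/

lemma exists_eq_sq_of_two_le_rootMultiplicity {P : Polynomial ℂ} (hP : P ≠ 0)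
    (hdeg : P.natDegree ≤ 4) (hdeg3 : P.natDegree ≠ 3)
    (h : ∀ r, P.IsRoot r → 2 ≤ P.rootMultiplicity r) :
    ∃ g : Polynomial ℂ, P = g ^ 2 ∧ g.natDegree ≤ 2 := by
  classical
  have hsplit := IsAlgClosed.splits P
  have hcard : ∑ r ∈ P.roots.toFinset, P.rootMultiplicity r = P.natDegree := by
    rw [hsplit.natDegree_eq_card_roots, ← Multiset.toFinset_sum_count_eq]
    simp only [Polynomial.count_roots]
  have hmem : ∀ r ∈ P.roots.toFinset, 2 ≤ P.rootMultiplicity r := by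
    intro r hr
    rw [Multiset.mem_toFinset, Polynomial.mem_roots hP] at hr
    exact h r hr
  have heven : ∀ r ∈ P.roots.toFinset, Even (P.rootMultiplicity r) := by
    intro r hr
    by_contra hodd
    rw [Nat.not_even_iff_odd] at hodd
    have h2 := hmem r hr
    rw [← Finset.add_sum_erase _ _ hr] at hcard
    obtain ⟨m, hm⟩ := hodd
    have h1 : ∑ x ∈ P.roots.toFinset.erase r, P.rootMultiplicity x = 1 := by omega
    obtain ⟨x, hx, hx0⟩ := Finset.exists_ne_zero_of_sum_ne_zero (h1.trans_ne one_ne_zero)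
    have hx2 := hmem x (Finset.mem_of_mem_erase hx)
    have := Finset.single_le_sum (f := fun x => P.rootMultiplicity x) (fun _ _ => Nat.zero_le _) hx
    omega
  obtain ⟨κ, hκ⟩ := IsAlgClosed.exists_pow_nat_eq P.leadingCoeff (n := 2) (by norm_num)
  have hfac : P = (Polynomial.C κ * ∏ r ∈ P.roots.toFinset,
      (Polynomial.X - Polynomial.C r) ^ (P.rootMultiplicity r / 2)) ^ 2 := by
    conv_lhs => rw [hsplit.eq_prod_roots, Polynomial.prod_multiset_root_eq_finset_root]
    rw [mul_pow, ← Polynomial.C_pow, hκ, ← Finset.prod_pow]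
    congr 1
    refine Finset.prod_congr rfl fun r hr => ?_
    rw [← pow_mul, Nat.div_mul_cancel (heven r hr).two_dvd]
  refine ⟨_, hfac, ?_⟩
  have := congrArg Polynomial.natDegree hfac
  rw [Polynomial.natDegree_pow] at this
  omega

lemma quarticPoly_natDegree_le (c₀ c₁ c₂ c₃ c₄ : ℂ) :
    (quarticPoly c₀ c₁ c₂ c₃ c₄).natDegree ≤ 4 := by
  rw [Polynomial.natDegree_le_iff_coeff_eq_zero]
  intro n hn
  rw [quarticPoly_coeff]
  simp [show n ≠ 0 by omega, show n ≠ 1 by omega, show n ≠ 2 by omega, show n ≠ 3 by omega,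
    show n ≠ 4 by omega]

/-- A line lies outside a plane quartic and is everywhere tangent to it exactly when the
restriction of the quartic to it is the square of a nonzero binary quadratic form. -/
lemma everywhereTangent_iff_sq {F : MvPolynomial (Fin 3) ℂ} (hF : F.IsHomogeneous 4)
    {u v : Fin 3 → ℂ} (huv : LinearIndependent ℂ ![u, v]) :
    (¬ lineThrough u v ⊆ curve F ∧ EverywhereTangent F (lineThrough u v)) ↔
      ∃ g₀ g₁ g₂ : ℂ, ¬ (g₀ = 0 ∧ g₁ = 0 ∧ g₂ = 0) ∧
        ∀ x y : ℂ, eval (x • u + y • v) F = (g₀ * x ^ 2 + g₁ * x * y + g₂ * y ^ 2) ^ 2 := by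
  have hne : ∀ x y : ℂ, ¬ (x = 0 ∧ y = 0) → x • u + y • v ≠ 0 := fun x y h e =>
    h (linearIndependent_pair_iff.1 huv x y e)
  constructor
  · rintro ⟨hsub, hT⟩
    obtain ⟨k, hk⟩ := exists_coords_form hF u v 0
    obtain ⟨c₀, c₁, c₂, c₃, c₄, hc⟩ : ∃ c₀ c₁ c₂ c₃ c₄ : ℂ, ∀ x y : ℂ, eval (x • u + y • v) F =
        c₀ * x ^ 4 + c₁ * x ^ 3 * y + c₂ * x ^ 2 * y ^ 2 + c₃ * x * y ^ 3 + c₄ * y ^ 4 := by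
      refine ⟨k 0, k 1, k 3, k 6, k 10, fun x y => ?_⟩
      have := hk x y 0
      rw [zero_smul, add_zero] at this
      rw [this]
      ring
    have hrest : lineRest F u v = quarticPoly c₀ c₁ c₂ c₃ c₄ := by
      refine Polynomial.funext fun t => ?_
      rw [lineRest_eval, quarticPoly_eval, show u + t • v = (1 : ℂ) • u + t • v by module, hc]
      ring
    have hrest' : lineRest F v u = quarticPoly c₄ c₃ c₂ c₁ c₀ := by
      refine Polynomial.funext fun t => ?_
      rw [lineRest_eval, quarticPoly_eval, show v + t • u = t • u + (1 : ℂ) • v by module, hc]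
      ring
    have hnz : ∃ x y : ℂ, eval (x • u + y • v) F ≠ 0 := by
      by_contra! hall
      apply hsub
      rintro p ⟨s, t, h, rfl⟩
      rw [mem_curve_mk_iff hF]
      exact hall s t
    have hcoef : ¬ (c₀ = 0 ∧ c₁ = 0 ∧ c₂ = 0 ∧ c₃ = 0 ∧ c₄ = 0) := by
      rintro ⟨rfl, rfl, rfl, rfl, rfl⟩
      obtain ⟨x, y, h⟩ := hnz
      simp [hc] at h
    have hP : quarticPoly c₀ c₁ c₂ c₃ c₄ ≠ 0 := by
      intro h0
      apply hcoef
      have := fun n => congrArg (fun P => Polynomial.coeff P n) h0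
      simp only [quarticPoly_coeff, Polynomial.coeff_zero] at this
      exact ⟨by simpa using this 0, by simpa using this 1, by simpa using this 2,
        by simpa using this 3, by simpa using this 4⟩
    have hP' : quarticPoly c₄ c₃ c₂ c₁ c₀ ≠ 0 := by
      intro h0
      apply hcoef
      have := fun n => congrArg (fun P => Polynomial.coeff P n) h0
      simp only [quarticPoly_coeff, Polynomial.coeff_zero] at this
      exact ⟨by simpa using this 4, by simpa using this 3, by simpa using this 2,
        by simpa using this 1, by simpa using this 0⟩
    have hinf : c₄ = 0 → c₃ = 0 := by
      intro h4
      have hv : v ≠ 0 := by simpa using hne 0 1 (by simp)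
      have hu' : v = (0 : ℂ) • u + (1 : ℂ) • v := by module
      have hv' : u = (1 : ℂ) • u + (0 : ℂ) • v := by module
      have hm := hT v u (linearIndependent_pair_of_det huv hu' hv' (by norm_num))
        (lineThrough_eq hu' hv' (by norm_num)).symm hv
        ((mem_curve_mk_iff hF hv).2 (by rw [hu', hc, h4]; ring))
      rw [multAt, hrest', Polynomial.le_rootMultiplicity_iff hP', Polynomial.C_0, sub_zero,
        Polynomial.X_pow_dvd_iff] at hm
      simpa [quarticPoly_coeff] using hm 1 (by norm_num)
    have hroot : ∀ r, (quarticPoly c₀ c₁ c₂ c₃ c₄).IsRoot r →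
        2 ≤ (quarticPoly c₀ c₁ c₂ c₃ c₄).rootMultiplicity r := by
      intro r hr
      have hu' : u + r • v = (1 : ℂ) • u + r • v := by module
      have hv' : v = (0 : ℂ) • u + (1 : ℂ) • v := by module
      have hw : u + r • v ≠ 0 := by rw [hu']; exact hne 1 r (by simp)
      have hm := hT (u + r • v) v (linearIndependent_pair_of_det huv hu' hv' (by norm_num))
        (lineThrough_eq hu' hv' (by norm_num)).symm hw
        ((mem_curve_mk_iff hF hw).2 (by rw [← lineRest_eval, hrest]; exact hr))
      have hcomp : lineRest F (u + r • v) v =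
          (quarticPoly c₀ c₁ c₂ c₃ c₄).comp (Polynomial.X + Polynomial.C r) := by
        refine Polynomial.funext fun t => ?_
        rw [lineRest_eval, Polynomial.eval_comp, ← hrest, lineRest_eval]
        congr 2
        simp
        module
      rwa [multAt, hcomp, ← Polynomial.rootMultiplicity_eq_rootMultiplicity] at hm
    obtain ⟨g, hg, hgdeg⟩ := exists_eq_sq_of_two_le_rootMultiplicity hP
      (quarticPoly_natDegree_le ..) (by
        intro h3
        have hlc := Polynomial.leadingCoeff_ne_zero.2 hP
        have h4 : (quarticPoly c₀ c₁ c₂ c₃ c₄).coeff 4 = 0 :=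
          Polynomial.coeff_eq_zero_of_natDegree_lt (by omega)
        rw [Polynomial.leadingCoeff, h3, quarticPoly_coeff] at hlc
        rw [quarticPoly_coeff] at h4
        exact hlc (by simpa using hinf (by simpa using h4))) hroot
    have hg' : g = quarticPoly (g.coeff 0) (g.coeff 1) (g.coeff 2) 0 0 := by
      conv_lhs => rw [g.as_sum_range_C_mul_X_pow' (n := 3) (by omega)]
      simp [Finset.sum_range_succ, quarticPoly]
    have hsq : quarticPoly c₀ c₁ c₂ c₃ c₄ = quarticPoly (g.coeff 0 ^ 2)
        (2 * g.coeff 0 * g.coeff 1) (g.coeff 1 ^ 2 + 2 * g.coeff 0 * g.coeff 2)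
        (2 * g.coeff 1 * g.coeff 2) (g.coeff 2 ^ 2) := by
      rw [hg]
      refine Polynomial.funext fun t => ?_
      rw [Polynomial.eval_pow]
      conv_lhs => rw [hg']
      rw [quarticPoly_eval, quarticPoly_eval]
      ring
    have hco := fun n => congrArg (fun P => Polynomial.coeff P n) hsq
    simp only [quarticPoly_coeff] at hco
    have e0 : c₀ = g.coeff 0 ^ 2 := by simpa using hco 0
    have e1 : c₁ = 2 * g.coeff 0 * g.coeff 1 := by simpa using hco 1
    have e2 : c₂ = g.coeff 1 ^ 2 + 2 * g.coeff 0 * g.coeff 2 := by simpa using hco 2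
    have e3 : c₃ = 2 * g.coeff 1 * g.coeff 2 := by simpa using hco 3
    have e4 : c₄ = g.coeff 2 ^ 2 := by simpa using hco 4
    refine ⟨g.coeff 0, g.coeff 1, g.coeff 2, ?_, fun x y => ?_⟩
    · rintro ⟨h0, h1, h2⟩
      apply hcoef
      rw [e0, e1, e2, e3, e4, h0, h1, h2]
      simp
    · rw [hc, e0, e1, e2, e3, e4]
      ring
  · rintro ⟨g₀, g₁, g₂, hg, hsq⟩
    have hnz : ∃ x y : ℂ, g₀ * x ^ 2 + g₁ * x * y + g₂ * y ^ 2 ≠ 0 := by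
      by_contra! hall
      have h0 : g₀ = 0 := by simpa using hall 1 0
      have h2 : g₂ = 0 := by simpa using hall 0 1
      exact hg ⟨h0, by simpa [h0, h2] using hall 1 1, h2⟩
    obtain ⟨x₀, y₀, hxy⟩ := hnz
    refine ⟨fun hsub => ?_, ?_⟩
    · have hw : x₀ • u + y₀ • v ≠ 0 := hne _ _ (by rintro ⟨rfl, rfl⟩; simp at hxy)
      have := (mem_curve_mk_iff hF hw).1 (hsub ((mk_mem_lineThrough hw).2 ⟨_, _, rfl⟩))
      rw [hsq] at this
      exact hxy (pow_eq_zero_iff (two_ne_zero) |>.1 this)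
    · intro a b hab hS ha hmem
      have hb : b ≠ 0 := by
        have := hab.ne_zero 1
        simpa using this
      obtain ⟨α, β, rfl⟩ := (mk_mem_lineThrough (u := u) (v := v) ha).1
        (by rw [hS]; exact (mk_mem_lineThrough ha).2 ⟨1, 0, by module⟩)
      obtain ⟨γ, δ, rfl⟩ := (mk_mem_lineThrough (u := u) (v := v) hb).1
        (by rw [hS]; exact (mk_mem_lineThrough hb).2 ⟨0, 1, by module⟩)
      rw [mem_curve_mk_iff hF, hsq, sq_eq_zero_iff] at hmem
      set g : Polynomial ℂ := quarticPoly (g₀ * α ^ 2 + g₁ * α * β + g₂ * β ^ 2)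
        (2 * g₀ * α * γ + g₁ * (α * δ + β * γ) + 2 * g₂ * β * δ)
        (g₀ * γ ^ 2 + g₁ * γ * δ + g₂ * δ ^ 2) 0 0 with hgdef
      have hrest : lineRest F (α • u + β • v) (γ • u + δ • v) = g ^ 2 := by
        refine Polynomial.funext fun t => ?_
        rw [lineRest_eval, show α • u + β • v + t • (γ • u + δ • v) =
          (α + t * γ) • u + (β + t * δ) • v by module, hsq, Polynomial.eval_pow, hgdef,
          quarticPoly_eval]
        ring
      have hg0 : g ^ 2 ≠ 0 := by
        intro h0
        have hmem' := (mk_mem_lineThrough (u := α • u + β • v) (v := γ • u + δ • v)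
          (hne x₀ y₀ (by rintro ⟨rfl, rfl⟩; simp at hxy))).1
          (by rw [← hS]; exact (mk_mem_lineThrough _).2 ⟨x₀, y₀, rfl⟩)
        obtain ⟨s, t, hst⟩ := hmem'
        have hz := linearIndependent_pair_iff.1 huv (x₀ - (s * α + t * γ)) (y₀ - (s * β + t * δ))
          (by rw [show (x₀ - (s * α + t * γ)) • u + (y₀ - (s * β + t * δ)) • v =
            (x₀ • u + y₀ • v) - (s • (α • u + β • v) + t • (γ • u + δ • v)) by module, hst,
            sub_self])
        have hco := fun n => congrArg (fun P => Polynomial.coeff P n)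
          (pow_eq_zero_iff (two_ne_zero) |>.1 h0)
        simp only [hgdef, quarticPoly_coeff, Polynomial.coeff_zero] at hco
        have e0 : g₀ * α ^ 2 + g₁ * α * β + g₂ * β ^ 2 = 0 := by simpa using hco 0
        have e1 : 2 * g₀ * α * γ + g₁ * (α * δ + β * γ) + 2 * g₂ * β * δ = 0 := by
          simpa using hco 1
        have e2 : g₀ * γ ^ 2 + g₁ * γ * δ + g₂ * δ ^ 2 = 0 := by simpa using hco 2
        apply hxy
        rw [sub_eq_zero.1 hz.1, sub_eq_zero.1 hz.2]
        linear_combination s ^ 2 * e0 + s * t * e1 + t ^ 2 * e2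
      rw [multAt, hrest, Polynomial.le_rootMultiplicity_iff hg0, Polynomial.C_0, sub_zero]
      refine pow_dvd_pow_of_dvd ?_ 2
      rw [Polynomial.X_dvd_iff, hgdef, quarticPoly_coeff]
      simpa using hmem

/-! ### The branch sextic of the projection from the node -/

/-- The discriminant of `nodalForm d e z x y` as a quadratic polynomial in `z`, divided by `4`. -/
def branchForm (d : Fin 4 → ℂ) (e : Fin 5 → ℂ) (x y : ℂ) : ℂ :=
  (d 0 * x ^ 3 + d 1 * x ^ 2 * y + d 2 * x * y ^ 2 + d 3 * y ^ 3) ^ 2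
    - x * y * (e 0 * x ^ 4 + e 1 * x ^ 3 * y + e 2 * x ^ 2 * y ^ 2 + e 3 * x * y ^ 3 + e 4 * y ^ 4)

/-- Coordinates `z, x, y` in which a quartic with a single node at `[a]` is a nodal form. -/
structure NodalFrame (F : MvPolynomial (Fin 3) ℂ) (a b₁ b₂ : Fin 3 → ℂ) (d : Fin 4 → ℂ)
    (e : Fin 5 → ℂ) : Prop where
  isHomogeneous : F.IsHomogeneous 4
  linearIndependent : LinearIndependent ℂ ![a, b₁, b₂]
  eval_eq : ∀ z x y : ℂ, eval (z • a + x • b₁ + y • b₂) F = nodalForm d e z x y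
  only_singular : ∀ (w : Fin 3 → ℂ) (hw : w ≠ 0),
    IsSingularAt F (Projectivization.mk ℂ w hw) → ∃ c : ℂ, w = c • a

namespace NodalFrame

variable {F : MvPolynomial (Fin 3) ℂ} {a b₁ b₂ : Fin 3 → ℂ} {d : Fin 4 → ℂ} {e : Fin 5 → ℂ}

lemma swap (h : NodalFrame F a b₁ b₂ d e) :
    NodalFrame F a b₂ b₁ ![d 3, d 2, d 1, d 0] ![e 4, e 3, e 2, e 1, e 0] where
  isHomogeneous := h.isHomogeneous
  linearIndependent := by
    rw [Fintype.linearIndependent_iff]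
    intro g hg
    simp only [Fin.sum_univ_three, Matrix.cons_val] at hg
    rw [add_right_comm] at hg
    obtain ⟨h0, h1, h2⟩ := eq_zero_of_smul_add_eq_zero h.linearIndependent hg
    intro i
    fin_cases i <;> assumption
  eval_eq z x y := by
    rw [add_right_comm, h.eval_eq]
    simp only [nodalForm, Matrix.cons_val]
    ring
  only_singular := h.only_singular

lemma eval_add_smul (h : NodalFrame F a b₁ b₂ d e) (z₀ x₀ y₀ z₁ x₁ y₁ t : ℂ) :
    (lineRest F (z₀ • a + x₀ • b₁ + y₀ • b₂) (z₁ • a + x₁ • b₁ + y₁ • b₂)).eval t =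
      nodalForm d e (z₀ + t * z₁) (x₀ + t * x₁) (y₀ + t * y₁) := by
  rw [lineRest_eval, ← h.eval_eq]
  congr 2
  module

lemma eq_zero_of_singular (h : NodalFrame F a b₁ b₂ d e) {z₀ x₀ y₀ : ℂ}
    (hs : ∀ z₁ x₁ y₁ : ℂ, (Polynomial.X : Polynomial ℂ) ^ 2 ∣
      lineRest F (z₀ • a + x₀ • b₁ + y₀ • b₂) (z₁ • a + x₁ • b₁ + y₁ • b₂)) :
    x₀ = 0 ∧ y₀ = 0 := by
  by_cases hw : z₀ • a + x₀ • b₁ + y₀ • b₂ = 0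
  · exact (eq_zero_of_smul_add_eq_zero h.linearIndependent hw).2
  · obtain ⟨c, hc⟩ := h.only_singular _ hw (isSingularAt_mk h.isHomogeneous hw fun v => by
      obtain ⟨z, x, y, rfl⟩ := exists_eq_smul_add h.linearIndependent v
      exact hs z x y)
    refine (eq_zero_of_smul_add_eq_zero h.linearIndependent (z := z₀ - c) ?_).2
    rw [show (z₀ - c) • a + x₀ • b₁ + y₀ • b₂ = (z₀ • a + x₀ • b₁ + y₀ • b₂) - c • a by module, hc,
      sub_self]

lemma not_d_three_e_four_eq_zero (h : NodalFrame F a b₁ b₂ d e) : ¬ (d 3 = 0 ∧ e 4 = 0) := by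
  rintro ⟨hd, he⟩
  obtain ⟨r, hr⟩ := IsAlgClosed.exists_pow_nat_eq (d 2 ^ 2 - e 3) (n := 2) (by norm_num)
  have := h.eq_zero_of_singular (z₀ := r - d 2) (x₀ := 0) (y₀ := 1) fun z₁ x₁ y₁ => by
    let x : Polynomial ℂ := Polynomial.C x₁ * Polynomial.X
    let y : Polynomial ℂ := 1 + Polynomial.C y₁ * Polynomial.X
    let z : Polynomial ℂ := Polynomial.C (r - d 2) + Polynomial.C z₁ * Polynomial.X
    let K : Polynomial ℂ := y * z ^ 2 + 2 * (Polynomial.C (d 0) * x ^ 2 + Polynomial.C (d 1) * x * y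
      + Polynomial.C (d 2) * y ^ 2) * z + (Polynomial.C (e 0) * x ^ 3
      + Polynomial.C (e 1) * x ^ 2 * y + Polynomial.C (e 2) * x * y ^ 2
      + Polynomial.C (e 3) * y ^ 3)
    have hK : Polynomial.X ∣ K := by
      rw [Polynomial.X_dvd_iff, Polynomial.coeff_zero_eq_eval_zero]
      simp [K, x, y, z]
      linear_combination hr
    obtain ⟨K', hK'⟩ := hK
    refine ⟨Polynomial.C x₁ * K', ?_⟩
    rw [show Polynomial.X ^ 2 * (Polynomial.C x₁ * K') = x * (Polynomial.X * K') by
      simp only [x]; ring, ← hK']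
    refine Polynomial.funext fun t => ?_
    rw [h.eval_add_smul]
    simp [K, x, y, z, nodalForm, hd, he]
    ring
  simp at this

lemma not_d_zero_e_zero_eq_zero (h : NodalFrame F a b₁ b₂ d e) : ¬ (d 0 = 0 ∧ e 0 = 0) := by
  simpa using h.swap.not_d_three_e_four_eq_zero

/-- The branch sextic has no multiple root. -/
lemma branchForm_no_double_root (h : NodalFrame F a b₁ b₂ d e) {x₀ y₀ : ℂ}
    (hN : ∀ x₁ y₁ : ℂ, ∃ N : Polynomial ℂ, ∀ t : ℂ,
      branchForm d e (x₀ + t * x₁) (y₀ + t * y₁) = t ^ 2 * N.eval t) :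
    x₀ = 0 ∧ y₀ = 0 := by
  have hx : ∀ {b₁ b₂ : Fin 3 → ℂ} {d : Fin 4 → ℂ} {e : Fin 5 → ℂ} {y₀ : ℂ},
      NodalFrame F a b₁ b₂ d e → (∃ N : Polynomial ℂ, ∀ t : ℂ,
        branchForm d e t y₀ = t ^ 2 * N.eval t) → y₀ = 0 := by
    intro b₁ b₂ d e y₀ h ⟨N, hN⟩
    by_contra hy
    have hd : d 3 = 0 := by
      simpa [branchForm, hy] using hN 0
    have hp : (Polynomial.C (d 0) * Polynomial.X ^ 2 + Polynomial.C (d 1 * y₀) * Polynomial.X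
          + Polynomial.C (d 2 * y₀ ^ 2)) ^ 2 * Polynomial.X
        - Polynomial.C y₀ * (Polynomial.C (e 0) * Polynomial.X ^ 4
          + Polynomial.C (e 1 * y₀) * Polynomial.X ^ 3
          + Polynomial.C (e 2 * y₀ ^ 2) * Polynomial.X ^ 2
          + Polynomial.C (e 3 * y₀ ^ 3) * Polynomial.X + Polynomial.C (e 4 * y₀ ^ 4))
        = Polynomial.X * N := by
      rw [← mul_right_inj' (Polynomial.X_ne_zero (R := ℂ))]
      refine Polynomial.funext fun t => ?_
      have := hN t
      simp only [branchForm, hd] at this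
      simp only [Polynomial.eval_mul, Polynomial.eval_sub, Polynomial.eval_add,
        Polynomial.eval_pow, Polynomial.eval_C, Polynomial.eval_X]
      linear_combination this
    have := congrArg (Polynomial.eval 0) hp
    exact h.not_d_three_e_four_eq_zero ⟨hd, by simpa [hy] using this⟩
  by_cases hx0 : x₀ = 0
  · subst hx0
    refine ⟨rfl, hx h ?_⟩
    obtain ⟨N, hN⟩ := hN 1 0
    exact ⟨N, fun t => by simpa using hN t⟩
  by_cases hy0 : y₀ = 0
  · subst hy0
    refine ⟨hx h.swap ?_, rfl⟩
    obtain ⟨N, hN⟩ := hN 0 1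
    refine ⟨N, fun t => ?_⟩
    rw [← hN t]
    simp [branchForm]
    ring
  set q := d 0 * x₀ ^ 3 + d 1 * x₀ ^ 2 * y₀ + d 2 * x₀ * y₀ ^ 2 + d 3 * y₀ ^ 3 with hq
  refine h.eq_zero_of_singular (z₀ := -q / (x₀ * y₀)) fun z₁ x₁ y₁ => ?_
  obtain ⟨N, hN⟩ := hN x₁ y₁
  let x : Polynomial ℂ := Polynomial.C x₀ + Polynomial.X * Polynomial.C x₁
  let y : Polynomial ℂ := Polynomial.C y₀ + Polynomial.X * Polynomial.C y₁
  let z : Polynomial ℂ := Polynomial.C (-q / (x₀ * y₀)) + Polynomial.X * Polynomial.C z₁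
  let K : Polynomial ℂ := x * y * z + (Polynomial.C (d 0) * x ^ 3 + Polynomial.C (d 1) * x ^ 2 * y
      + Polynomial.C (d 2) * x * y ^ 2 + Polynomial.C (d 3) * y ^ 3)
  have hK : Polynomial.X ∣ K := by
    rw [Polynomial.X_dvd_iff, Polynomial.coeff_zero_eq_eval_zero]
    simp only [K, x, y, z, Polynomial.eval_mul, Polynomial.eval_add, Polynomial.eval_pow,
      Polynomial.eval_C, Polynomial.eval_X, zero_mul, add_zero]
    rw [← hq]
    field_simp
    ring
  have hcop : IsCoprime ((Polynomial.X : Polynomial ℂ) ^ 2) (x * y) := by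
    refine IsCoprime.pow_left ((Polynomial.irreducible_X.coprime_iff_not_dvd).2 ?_)
    rw [Polynomial.X_dvd_iff, Polynomial.coeff_zero_eq_eval_zero]
    simp [x, y, hx0, hy0]
  refine hcop.dvd_of_dvd_mul_left ?_
  have hprod : x * y * lineRest F ((-q / (x₀ * y₀)) • a + x₀ • b₁ + y₀ • b₂)
      (z₁ • a + x₁ • b₁ + y₁ • b₂) = K ^ 2 - Polynomial.X ^ 2 * N := by
    refine Polynomial.funext fun t => ?_
    simp only [Polynomial.eval_mul, Polynomial.eval_sub, h.eval_add_smul, Polynomial.eval_pow,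
      Polynomial.eval_X, ← hN t]
    simp only [K, x, y, z, Polynomial.eval_mul, Polynomial.eval_add, Polynomial.eval_pow,
      Polynomial.eval_C, Polynomial.eval_X, nodalForm, branchForm]
    ring
  rw [hprod]
  exact dvd_sub (pow_dvd_pow_of_dvd hK 2) (Dvd.intro _ rfl)

end NodalFrame

lemma exists_eq_prod_linear {n : ℕ} (hn : 1 ≤ n) {P : Polynomial ℂ} (hP : P.natDegree ≤ n) :
    ∃ a b : Fin n → ℂ, P = ∏ i, (Polynomial.C (a i) * Polynomial.X + Polynomial.C (b i)) := by
  induction n, hn using Nat.le_induction generalizing P with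
  | base =>
    obtain ⟨a, b, h⟩ := Polynomial.exists_eq_X_add_C_of_natDegree_le_one hP
    exact ⟨fun _ => a, fun _ => b, by simpa using h⟩
  | succ n hn ih =>
    obtain ⟨α, β, Q, hQ, hPQ⟩ : ∃ (α β : ℂ) (Q : Polynomial ℂ), Q.natDegree ≤ n ∧
        P = (Polynomial.C α * Polynomial.X + Polynomial.C β) * Q := by
      by_cases hlt : P.natDegree ≤ n
      · exact ⟨0, 1, P, hlt, by simp⟩
      · obtain ⟨r, hr⟩ := IsAlgClosed.exists_root P
          (Polynomial.degree_ne_of_natDegree_ne (n := 0) (by omega))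
        obtain ⟨Q, rfl⟩ := Polynomial.dvd_iff_isRoot.2 hr
        have hQ0 : Q ≠ 0 := by
          rintro rfl
          simp at hlt
        rw [Polynomial.natDegree_mul (Polynomial.X_sub_C_ne_zero r) hQ0,
          Polynomial.natDegree_X_sub_C] at hP
        exact ⟨1, -r, Q, by omega, by simp [sub_eq_add_neg]⟩
    obtain ⟨a, b, rfl⟩ := ih hQ
    exact ⟨Fin.cons α a, Fin.cons β b, by rw [hPQ, Fin.prod_univ_succ]; simp⟩

lemma branchForm_smul (d : Fin 4 → ℂ) (e : Fin 5 → ℂ) (c x y : ℂ) :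
    branchForm d e (c * x) (c * y) = c ^ 6 * branchForm d e x y := by
  simp only [branchForm]
  ring

lemma exists_branchForm_eq_prod_linear (d : Fin 4 → ℂ) (e : Fin 5 → ℂ) :
    ∃ a b : Fin 6 → ℂ, ∀ x y, branchForm d e x y = ∏ i, (a i * x + b i * y) := by
  let P : Polynomial ℂ := (Polynomial.C (d 0) * Polynomial.X ^ 3
      + Polynomial.C (d 1) * Polynomial.X ^ 2 + Polynomial.C (d 2) * Polynomial.X
      + Polynomial.C (d 3)) ^ 2
    - Polynomial.X * quarticPoly (e 4) (e 3) (e 2) (e 1) (e 0)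
  have hdeg : P.natDegree ≤ 6 := by
    simp only [P, quarticPoly]
    compute_degree
  have heval : ∀ t, P.eval t = branchForm d e t 1 := fun t => by
    simp only [P, branchForm, Polynomial.eval_sub, Polynomial.eval_mul, quarticPoly_eval,
      Polynomial.eval_pow, Polynomial.eval_add, Polynomial.eval_C, Polynomial.eval_X]
    ring
  obtain ⟨a, b, hab⟩ := exists_eq_prod_linear (by norm_num) hdeg
  refine ⟨a, b, fun x y => ?_⟩
  refine congrFun (Continuous.ext_on (dense_compl_singleton (0 : ℂ))
    (f := fun y => branchForm d e x y) (g := fun y => ∏ i, (a i * x + b i * y)) ?_ ?_ ?_) y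
  · unfold branchForm
    fun_prop
  · fun_prop
  · intro y (hy : y ≠ 0)
    have := branchForm_smul d e y (x / y) 1
    rw [mul_div_cancel₀ _ hy, mul_one, ← heval, hab, Polynomial.eval_prod] at this
    simp only [this]
    rw [show y ^ 6 = ∏ _i : Fin 6, y by simp, ← Finset.prod_mul_distrib]
    refine Finset.prod_congr rfl fun i _ => ?_
    simp
    field_simp

/-- Square roots of the coefficients of linear factors, with a prescribed product. -/
lemma exists_sq_eq_and_prod_eq {n : ℕ} [NeZero n] (a : Fin n → ℂ) {c : ℂ} (h : ∏ i, a i = c ^ 2) :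
    ∃ u : Fin n → ℂ, (∀ i, u i ^ 2 = a i) ∧ ∏ i, u i = c := by
  choose u hu using fun i => IsAlgClosed.exists_pow_nat_eq (a i) (n := 2) (by norm_num)
  have hsq : (∏ i, u i) ^ 2 = c ^ 2 := by
    rw [← Finset.prod_pow, ← h]
    exact Finset.prod_congr rfl fun i _ => hu i
  rcases sq_eq_sq_iff_eq_or_eq_neg.1 hsq with h' | h'
  · exact ⟨u, hu, h'⟩
  · refine ⟨Function.update u 0 (-u 0), fun i => ?_, ?_⟩
    · by_cases hi : i = 0
      · subst hi
        simp [hu]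
      · simp [Function.update_of_ne hi, hu]
    · rw [Finset.prod_update_of_mem (Finset.mem_univ 0), neg_mul,
        Finset.sdiff_singleton_eq_erase, Finset.mul_prod_erase _ _ (Finset.mem_univ 0), h',
        neg_neg]

lemma exists_branchForm_eq_prod (d : Fin 4 → ℂ) (e : Fin 5 → ℂ) :
    ∃ u v : Fin 6 → ℂ, ∏ i, u i = d 0 ∧ ∏ i, v i = d 3 ∧
      ∀ x y, branchForm d e x y = ∏ i, (u i ^ 2 * x - v i ^ 2 * y) := by
  obtain ⟨a, b, hab⟩ := exists_branchForm_eq_prod_linear d e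
  have h0 := hab 1 0
  have h3 := hab 0 1
  obtain ⟨u, hu, hu'⟩ := exists_sq_eq_and_prod_eq a (c := d 0)
    (by rw [show ∏ i, a i = ∏ i, (a i * 1 + b i * 0) by simp, ← h0]; simp [branchForm])
  obtain ⟨v, hv, hv'⟩ := exists_sq_eq_and_prod_eq (fun i => -b i) (c := d 3) (by
    rw [show ∏ i, -b i = ∏ i, (a i * 0 + b i * 1) by simp [Fin.prod_univ_six], ← h3]
    simp [branchForm])
  refine ⟨u, v, hu', hv', fun x y => ?_⟩
  rw [hab]
  refine Finset.prod_congr rfl fun i _ => ?_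
  rw [hu, hv]
  ring

lemma NodalFrame.cross_ne {F : MvPolynomial (Fin 3) ℂ} {a b₁ b₂ : Fin 3 → ℂ} {d : Fin 4 → ℂ}
    {e : Fin 5 → ℂ} (h : NodalFrame F a b₁ b₂ d e) {u v : Fin 6 → ℂ}
    (hf : ∀ x y, branchForm d e x y = ∏ i, (u i ^ 2 * x - v i ^ 2 * y)) {i j : Fin 6}
    (hij : i ≠ j) : u i ^ 2 * v j ^ 2 ≠ u j ^ 2 * v i ^ 2 := by
  intro hc
  by_cases hi : v i ^ 2 = 0 ∧ u i ^ 2 = 0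
  · refine one_ne_zero (h.branchForm_no_double_root (x₀ := 1) (y₀ := 1) fun x₁ y₁ =>
      ⟨0, fun t => ?_⟩).1
    rw [hf, Finset.prod_eq_zero (Finset.mem_univ i) (by rw [hi.1, hi.2]; ring)]
    simp
  · refine hi (h.branchForm_no_double_root fun x₁ y₁ => ⟨Polynomial.C (u i ^ 2 * x₁ - v i ^ 2 * y₁) *
      (Polynomial.C (u j ^ 2 * x₁ - v j ^ 2 * y₁) * ∏ k ∈ (Finset.univ.erase i).erase j,
        (Polynomial.C (u k ^ 2) * (Polynomial.C (v i ^ 2) + Polynomial.X * Polynomial.C x₁)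
        - Polynomial.C (v k ^ 2) * (Polynomial.C (u i ^ 2) + Polynomial.X * Polynomial.C y₁))),
      fun t => ?_⟩)
    rw [hf, ← Finset.mul_prod_erase _ _ (Finset.mem_univ i),
      ← Finset.mul_prod_erase _ _ (Finset.mem_erase.2 ⟨hij.symm, Finset.mem_univ j⟩)]
    simp only [Polynomial.eval_mul, Polynomial.eval_C, Polynomial.eval_prod, Polynomial.eval_sub,
      Polynomial.eval_add, Polynomial.eval_X]
    linear_combination -(u i ^ 2 * x₁ - v i ^ 2 * y₁) * t * (∏ k ∈ (Finset.univ.erase i).erase j,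
      (u k ^ 2 * (v i ^ 2 + t * x₁) - v k ^ 2 * (u i ^ 2 + t * y₁))) * hc

/-! ### Sign choices for the square roots of the branch sextic -/

lemma intCast_units_sq (ε : ℤˣ) : ((ε : ℤ) : ℂ) ^ 2 = 1 := by
  rcases Int.units_eq_one_or ε with rfl | rfl <;> simp

/-- A polynomial `Ψ` with `Ψ(t) Ψ(-t) = ∏ (vᵢ² - uᵢ² t²)` is a product of linear factors
`uᵢ t ± vᵢ`, up to sign. -/
lemma exists_eq_prod_of_eval_mul_eval_neg {ι : Type*} (u v : ι → ℂ) (S : Finset ι)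
    {Ψ : Polynomial ℂ}
    (h : ∀ t, Ψ.eval t * Ψ.eval (-t) = ∏ i ∈ S, (v i ^ 2 - u i ^ 2 * t ^ 2)) :
    ∃ (κ : ℤˣ) (ε : ι → ℤˣ), Ψ = Polynomial.C ((κ : ℤ) : ℂ) *
      ∏ i ∈ S, (Polynomial.C (u i) * Polynomial.X - Polynomial.C (((ε i : ℤ) : ℂ) * v i)) := by
  classical
  induction S using Finset.induction_on generalizing Ψ with
  | empty =>
    have hunit : IsUnit Ψ := IsUnit.of_mul_eq_one (Ψ.comp (-Polynomial.X))
      (Polynomial.funext fun t => by simpa using h t)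
    obtain ⟨c, -, rfl⟩ := Polynomial.isUnit_iff.1 hunit
    have hc : c ^ 2 = 1 := by
      rw [sq]
      simpa using h 0
    rcases eq_or_eq_neg_of_sq_eq_sq c 1 (by rw [hc, one_pow]) with rfl | rfl
    · exact ⟨1, 1, by simp⟩
    · exact ⟨-1, 1, by simp⟩
  | insert i S hi ih =>
    by_cases h0 : u i = 0 ∧ v i = 0
    · have hΨ : Ψ * Ψ.comp (-Polynomial.X) = 0 := Polynomial.funext fun t => by
        simpa [Finset.prod_insert hi, h0] using h t
      refine ⟨1, 1, ?_⟩
      rw [Finset.prod_insert hi, h0.1, h0.2]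
      rcases mul_eq_zero.1 hΨ with hΨ | hΨ
      · simpa using hΨ
      · refine Polynomial.funext fun t => ?_
        simpa using congrArg (Polynomial.eval (-t)) hΨ
    obtain ⟨δ, Ψ', hΨ⟩ : ∃ δ : ℤˣ,
        Polynomial.C (u i) * Polynomial.X - Polynomial.C (((δ : ℤ) : ℂ) * v i) ∣ Ψ := by
      by_cases hu : u i = 0
      · refine ⟨1, IsUnit.dvd ?_⟩
        have hv : v i ≠ 0 := fun hv => h0 ⟨hu, hv⟩
        simpa [hu] using hv
      · obtain ⟨δ, hδ⟩ : ∃ δ : ℤˣ, Ψ.eval (((δ : ℤ) : ℂ) * v i / u i) = 0 := by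
          have := h (v i / u i)
          rw [Finset.prod_insert hi, show v i ^ 2 - u i ^ 2 * (v i / u i) ^ 2 = 0 by
            field_simp; ring, zero_mul] at this
          rcases mul_eq_zero.1 this with h | h
          · exact ⟨1, by simpa using h⟩
          · exact ⟨-1, by simpa [neg_div] using h⟩
        refine ⟨δ, ?_⟩
        rw [show Polynomial.C (u i) * Polynomial.X - Polynomial.C (((δ : ℤ) : ℂ) * v i) =
          Polynomial.C (u i) * (Polynomial.X - Polynomial.C (((δ : ℤ) : ℂ) * v i / u i)) by
            rw [mul_sub, ← Polynomial.C_mul, mul_div_cancel₀ _ hu],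
          IsUnit.mul_left_dvd (Polynomial.isUnit_C.2 (isUnit_iff_ne_zero.2 hu)),
          Polynomial.dvd_iff_isRoot]
        exact hδ
    have hM : Polynomial.C (v i ^ 2) - Polynomial.C (u i ^ 2) * Polynomial.X ^ 2 ≠ 0 := by
      intro hM
      have e0 := congrArg (Polynomial.eval 0) hM
      have e1 := congrArg (Polynomial.eval 1) hM
      simp at e0 e1
      simp [e0] at e1
      exact h0 ⟨e1, e0⟩
    have h' : Ψ' * Ψ'.comp (-Polynomial.X) =
        ∏ i ∈ S, (Polynomial.C (v i ^ 2) - Polynomial.C (u i ^ 2) * Polynomial.X ^ 2) := by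
      refine mul_left_cancel₀ hM (Polynomial.funext fun t => ?_)
      have := h t
      rw [Finset.prod_insert hi, hΨ] at this
      simp only [Polynomial.eval_mul, Polynomial.eval_sub, Polynomial.eval_C, Polynomial.eval_X,
        Polynomial.eval_pow, Polynomial.eval_prod, Polynomial.eval_comp,
        Polynomial.eval_neg] at this ⊢
      rw [← this]
      linear_combination -(v i ^ 2 * Ψ'.eval t * Ψ'.eval (-t)) * intCast_units_sq δ
    obtain ⟨κ, ε, hε⟩ := ih (Ψ := Ψ') fun t => by
      simpa [Polynomial.eval_prod] using congrArg (Polynomial.eval t) h'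
    refine ⟨κ, Function.update ε i δ, ?_⟩
    rw [hΨ, hε, Finset.prod_insert hi, Function.update_self, mul_left_comm]
    congr 2
    refine Finset.prod_congr rfl fun j hj => ?_
    rw [Function.update_of_ne (ne_of_mem_of_not_mem hj hi)]

/-- The product of the linear factors `uᵢ X - εᵢ vᵢ`. -/
def signPoly (u v : Fin 6 → ℂ) (ε : Fin 6 → ℤˣ) : Polynomial ℂ :=
  ∏ i, (Polynomial.C (u i) * Polynomial.X - Polynomial.C (((ε i : ℤ) : ℂ) * v i))

lemma signPoly_eval (u v : Fin 6 → ℂ) (ε : Fin 6 → ℤˣ) (t : ℂ) :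
    (signPoly u v ε).eval t = ∏ i, (u i * t - ((ε i : ℤ) : ℂ) * v i) := by
  simp [signPoly, Polynomial.eval_prod]

lemma signPoly_eval_neg (u v : Fin 6 → ℂ) (ε : Fin 6 → ℤˣ) (t : ℂ) :
    (signPoly u v ε).eval (-t) = (signPoly u v (-ε)).eval t := by
  simp only [signPoly_eval, Fin.prod_univ_six, Pi.neg_apply, Units.val_neg, Int.cast_neg]
  ring

lemma signPoly_eval_mul_eval_neg (u v : Fin 6 → ℂ) (ε : Fin 6 → ℤˣ) (t : ℂ) :
    (signPoly u v ε).eval t * (signPoly u v ε).eval (-t) = ∏ i, (u i ^ 2 * t ^ 2 - v i ^ 2) := by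
  rw [signPoly_eval_neg, signPoly_eval, signPoly_eval, ← Finset.prod_mul_distrib]
  refine Finset.prod_congr rfl fun i _ => ?_
  simp only [Pi.neg_apply, Units.val_neg, Int.cast_neg]
  linear_combination -(v i ^ 2) * intCast_units_sq (ε i)

lemma signPoly_coeff_zero (u v : Fin 6 → ℂ) (ε : Fin 6 → ℤˣ) :
    (signPoly u v ε).coeff 0 = (((∏ i, ε i : ℤˣ) : ℤ) : ℂ) * ∏ i, v i := by
  rw [Polynomial.coeff_zero_eq_eval_zero, signPoly_eval]
  simp only [Fin.prod_univ_six, Units.val_mul, Int.cast_mul]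
  ring

lemma signPoly_natDegree_le (u v : Fin 6 → ℂ) (ε : Fin 6 → ℤˣ) :
    (signPoly u v ε).natDegree ≤ 6 := by
  refine (Polynomial.natDegree_prod_le _ _).trans ?_
  refine (Finset.sum_le_card_nsmul _ _ 1 fun i _ => ?_).trans (by simp)
  compute_degree

lemma signPoly_coeff_six (u v : Fin 6 → ℂ) (ε : Fin 6 → ℤˣ) :
    (signPoly u v ε).coeff 6 = ∏ i, u i := by
  have := Polynomial.coeff_prod_of_natDegree_le (s := Finset.univ)
    (f := fun i => Polynomial.C (u i) * Polynomial.X - Polynomial.C (((ε i : ℤ) : ℂ) * v i)) 1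
    (fun i _ => by compute_degree)
  simpa only [signPoly, mul_one, Finset.card_univ, Fintype.card_fin, Polynomial.coeff_sub,
    Polynomial.coeff_C_mul, Polynomial.coeff_X_one, Polynomial.coeff_C_succ, sub_zero] using this

lemma signPoly_eval_eq_sum (u v : Fin 6 → ℂ) (ε : Fin 6 → ℤˣ) (t : ℂ) :
    (signPoly u v ε).eval t = (((∏ i, ε i : ℤˣ) : ℤ) : ℂ) * ∏ i, v i
      + (signPoly u v ε).coeff 1 * t + (signPoly u v ε).coeff 2 * t ^ 2
      + (signPoly u v ε).coeff 3 * t ^ 3 + (signPoly u v ε).coeff 4 * t ^ 4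
      + (signPoly u v ε).coeff 5 * t ^ 5 + (∏ i, u i) * t ^ 6 := by
  rw [Polynomial.eval_eq_sum_range' (n := 7)
    (by have := signPoly_natDegree_le u v ε; omega), ← signPoly_coeff_zero u v ε,
    ← signPoly_coeff_six u v ε]
  simp [Finset.sum_range_succ]

/-- The linear factors of the branch sextic are pairwise non-proportional. -/
def CrossNe (u v : Fin 6 → ℂ) : Prop :=
  ∀ i j, i ≠ j → u i ^ 2 * v j ^ 2 ≠ u j ^ 2 * v i ^ 2

lemma signPoly_injective {u v : Fin 6 → ℂ} (hc : CrossNe u v) {ε ε' : Fin 6 → ℤˣ}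
    (h : signPoly u v ε = signPoly u v ε') (hp : ∏ i, ε i = ∏ i, ε' i) : ε = ε' := by
  have hu : ∀ i, u i ≠ 0 → v i ≠ 0 → ε i = ε' i := by
    intro i hui hvi
    have h1 := congrArg (Polynomial.eval (((ε i : ℤ) : ℂ) * v i / u i)) h
    rw [signPoly_eval, signPoly_eval, Finset.prod_eq_zero (Finset.mem_univ i)
      (by field_simp; ring), eq_comm, Finset.prod_eq_zero_iff] at h1
    obtain ⟨k, -, hk⟩ := h1
    by_cases hki : k = i
    · subst hki
      rw [mul_div_cancel₀ _ hui, ← sub_mul, mul_eq_zero, or_iff_left hvi, sub_eq_zero] at hk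
      exact Units.ext (by exact_mod_cast hk)
    · refine absurd ?_ (hc k i hki)
      field_simp at hk
      have hk' : u k * (((ε i : ℤ) : ℂ) * v i) = u i * (((ε' k : ℤ) : ℂ) * v k) := by
        linear_combination hk
      have := congrArg (· ^ 2) hk'
      simp only [mul_pow, intCast_units_sq] at this
      linear_combination this
  have hv : ∀ i, v i ≠ 0 → ε i = ε' i := by
    intro i hvi
    by_cases hui : u i = 0
    · have hother : ∏ k ∈ Finset.univ.erase i,
          (Polynomial.C (u k) * Polynomial.X - Polynomial.C (((ε k : ℤ) : ℂ) * v k)) =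
          ∏ k ∈ Finset.univ.erase i,
          (Polynomial.C (u k) * Polynomial.X - Polynomial.C (((ε' k : ℤ) : ℂ) * v k)) := by
        refine Finset.prod_congr rfl fun k hk => ?_
        by_cases hvk : v k = 0
        · simp [hvk]
        · rw [hu k (fun huk => hc k i (Finset.ne_of_mem_erase hk) (by simp [huk, hui])) hvk]
      have hne : ∏ k ∈ Finset.univ.erase i,
          (Polynomial.C (u k) * Polynomial.X - Polynomial.C (((ε' k : ℤ) : ℂ) * v k)) ≠ 0 := by
        rw [Finset.prod_ne_zero_iff]
        intro k hk h0
        have h1 := congrArg (fun p => Polynomial.coeff p 1) h0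
        simp only [Polynomial.coeff_sub, Polynomial.coeff_C_mul, Polynomial.coeff_X_one, mul_one,
          Polynomial.coeff_C_succ, sub_zero, Polynomial.coeff_zero] at h1
        exact hc k i (Finset.ne_of_mem_erase hk) (by simp [h1, hui])
      rw [signPoly, signPoly, ← Finset.mul_prod_erase _ _ (Finset.mem_univ i),
        ← Finset.mul_prod_erase _ _ (Finset.mem_univ i), hother] at h
      have := congrArg (fun p => Polynomial.coeff p 0) (mul_right_cancel₀ hne h)
      simp [hvi] at this
      exact Units.ext this
    · exact hu i hui hvi
  funext i
  by_cases hvi : v i = 0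
  · have hother : ∏ k ∈ Finset.univ.erase i, ε k = ∏ k ∈ Finset.univ.erase i, ε' k :=
      Finset.prod_congr rfl fun k hk =>
        hv k fun hvk => hc k i (Finset.ne_of_mem_erase hk) (by simp [hvk, hvi])
    rw [← Finset.mul_prod_erase _ _ (Finset.mem_univ i),
      ← Finset.mul_prod_erase _ ε' (Finset.mem_univ i), hother] at hp
    exact mul_right_cancel hp
  · exact hv i hvi

/-- The pairs `l` such that the restriction of the nodal form to the line `z = l₁ x + l₂ y` is the
square of a nonzero form. -/
def squareLines (d : Fin 4 → ℂ) (e : Fin 5 → ℂ) : Set (ℂ × ℂ) :=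
  {l | ∃ g₀ g₁ g₂ : ℂ, ¬ (g₀ = 0 ∧ g₁ = 0 ∧ g₂ = 0) ∧
    ∀ x y : ℂ, nodalForm d e (x * l.1 + y * l.2) x y = (g₀ * x ^ 2 + g₁ * x * y + g₂ * y ^ 2) ^ 2}

/-- The sign vectors with product `1`, normalized by `ε 0 = 1`. -/
def normalizedSigns : Set (Fin 6 → ℤˣ) := {ε | ε 0 = 1 ∧ ∏ i, ε i = 1}

lemma ncard_normalizedSigns : normalizedSigns.ncard = 16 := by
  let f : (Fin 4 → ℤˣ) → (Fin 6 → ℤˣ) := fun η => Fin.cons 1 (Fin.cons (∏ i, η i) η)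
  have hf : Function.Injective f := fun η η' h => by
    simpa [f] using congrArg (fun ε => Fin.tail (Fin.tail ε)) h
  have hrange : normalizedSigns = Set.range f := by
    ext ε
    constructor
    · rintro ⟨h0, h1⟩
      refine ⟨fun i => ε i.succ.succ, ?_⟩
      have h2 : ε 1 = ∏ i : Fin 4, ε i.succ.succ := by
        rw [Fin.prod_univ_succ, Fin.prod_univ_succ, h0, one_mul] at h1
        exact (eq_inv_of_mul_eq_one_left h1).trans (Int.units_inv_eq_self _)
      funext i
      refine Fin.cases h0.symm (fun i => Fin.cases ?_ (fun i => rfl) i) i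
      exact h2.symm
    · rintro ⟨η, rfl⟩
      refine ⟨rfl, ?_⟩
      rw [Fin.prod_univ_succ, Fin.prod_univ_succ]
      simp [f, Int.units_mul_self]
  rw [hrange, ← Set.image_univ, Set.ncard_image_of_injective _ hf, Set.ncard_univ]
  simp

lemma prod_neg_signs (ε : Fin 6 → ℤˣ) : ∏ i, (-ε) i = ∏ i, ε i := by
  simp [Fin.prod_univ_six]

/-- The slopes of the bitangent attached to a sign vector. -/
def signSlopes (d : Fin 4 → ℂ) (u v : Fin 6 → ℂ) (ε : Fin 6 → ℤˣ) : ℂ × ℂ :=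
  ((signPoly u v ε).coeff 4 - d 1, (signPoly u v ε).coeff 2 - d 2)

lemma injOn_signSlopes {d : Fin 4 → ℂ} {u v : Fin 6 → ℂ} (hc : CrossNe u v) :
    Set.InjOn (signSlopes d u v) normalizedSigns := by
  rintro ε ⟨h0, h1⟩ ε' ⟨h0', h1'⟩ h
  simp only [signSlopes, Prod.mk.injEq, sub_left_inj] at h
  have hmul : (signPoly u v ε - signPoly u v ε') * (signPoly u v ε - signPoly u v (-ε')) = 0 := by
    refine Polynomial.funext fun t => ?_
    have hp := (signPoly_eval_mul_eval_neg u v ε t).trans (signPoly_eval_mul_eval_neg u v ε' t).symm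
    simp only [Polynomial.eval_mul, Polynomial.eval_sub, Polynomial.eval_zero, ← signPoly_eval_neg]
    have hsum : (signPoly u v ε).eval t + (signPoly u v ε).eval (-t) =
        (signPoly u v ε').eval t + (signPoly u v ε').eval (-t) := by
      simp only [signPoly_eval_eq_sum, h1, h1', h.1, h.2]
      ring
    linear_combination (signPoly u v ε).eval t * hsum - hp
  rcases mul_eq_zero.1 hmul with h | h
  · exact signPoly_injective hc (sub_eq_zero.1 h) (h1.trans h1'.symm)
  · have := congrFun (signPoly_injective hc (sub_eq_zero.1 h)
      (by rw [h1, prod_neg_signs, h1'])) 0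
    rw [Pi.neg_apply, h0, h0'] at this
    exact absurd this (by decide)

/-- A quantity depending continuously on `x` and `y` vanishes if it vanishes off the axes. -/
lemma eq_zero_of_mul_mul_eq_zero {G : ℂ → ℂ → ℂ} (hx : ∀ y, Continuous fun x => G x y)
    (hy : ∀ x, Continuous (G x)) (h : ∀ x y, x ≠ 0 → y ≠ 0 → G x y = 0) (x y : ℂ) : G x y = 0 := by
  have h1 : ∀ x, x ≠ 0 → ∀ y, G x y = 0 := fun x hx0 => congrFun
    (Continuous.ext_on (dense_compl_singleton (0 : ℂ)) (hy x) continuous_const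
      fun y hy0 => h x y hx0 hy0)
  exact congrFun (Continuous.ext_on (dense_compl_singleton (0 : ℂ)) (hx y) continuous_const
    fun x hx0 => h1 x hx0 y) x

section

variable {d : Fin 4 → ℂ} {e : Fin 5 → ℂ} {u v : Fin 6 → ℂ}

lemma signSlopes_mem_squareLines (hu : ∏ i, u i = d 0) (hv : ∏ i, v i = d 3)
    (hf : ∀ x y, branchForm d e x y = ∏ i, (u i ^ 2 * x - v i ^ 2 * y)) (hc : CrossNe u v)
    {ε : Fin 6 → ℤˣ} (hε : ∏ i, ε i = 1) : signSlopes d u v ε ∈ squareLines d e := by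
  have hsum := fun t => signPoly_eval_eq_sum u v ε t
  simp only [hε, hu, hv, Units.val_one, Int.cast_one, one_mul] at hsum
  refine ⟨(signPoly u v ε).coeff 5, (signPoly u v ε).coeff 3, (signPoly u v ε).coeff 1, ?_, ?_⟩
  · rintro ⟨h5, h3, h1⟩
    have hneg : ε = -ε := by
      refine signPoly_injective hc (Polynomial.funext fun t => ?_) ?_
      · rw [← signPoly_eval_neg, hsum, hsum, h5, h3, h1]
        ring
      · rw [prod_neg_signs]
    have := congrFun hneg 0
    rcases Int.units_eq_one_or (ε 0) with h | h <;> simp [h] at this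
  · set c₁ := (signPoly u v ε).coeff 1
    set c₃ := (signPoly u v ε).coeff 3
    set c₅ := (signPoly u v ε).coeff 5
    simp only [signSlopes]
    set c₂ := (signPoly u v ε).coeff 2
    set c₄ := (signPoly u v ε).coeff 4
    have hone : ∀ x, x ≠ 0 → nodalForm d e (x * (c₄ - d 1) + (c₂ - d 2)) x 1 =
        (c₅ * x ^ 2 + c₃ * x + c₁) ^ 2 := by
      intro x hx
      obtain ⟨s, rfl⟩ := IsAlgClosed.exists_pow_nat_eq x (n := 2) (by norm_num)
      have h1 := signPoly_eval_mul_eval_neg u v ε s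
      have h2 := hf (s ^ 2) 1
      simp only [mul_one, branchForm] at h2
      rw [← h2, hsum, hsum] at h1
      refine mul_left_cancel₀ hx ?_
      simp only [nodalForm]
      linear_combination h1
    intro x y
    rw [← sub_eq_zero]
    refine eq_zero_of_mul_mul_eq_zero (G := fun x y =>
      nodalForm d e (x * (c₄ - d 1) + y * (c₂ - d 2)) x y -
        (c₅ * x ^ 2 + c₃ * x * y + c₁ * y ^ 2) ^ 2) ?_ ?_ ?_ x y
    · unfold nodalForm
      fun_prop
    · unfold nodalForm
      fun_prop
    · intro x y hx hy
      have := hone (x / y) (div_ne_zero hx hy)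
      simp only [nodalForm] at this ⊢
      field_simp at this
      linear_combination this

lemma exists_signSlopes_eq (hu : ∏ i, u i = d 0) (hv : ∏ i, v i = d 3)
    (hf : ∀ x y, branchForm d e x y = ∏ i, (u i ^ 2 * x - v i ^ 2 * y))
    {l : ℂ × ℂ} (hl : l ∈ squareLines d e) : ∃ ε ∈ normalizedSigns, signSlopes d u v ε = l := by
  obtain ⟨g₀, g₁, g₂, -, hg⟩ := hl
  let Ψ : Polynomial ℂ := Polynomial.C (d 0) * Polynomial.X ^ 6
    + Polynomial.C g₀ * Polynomial.X ^ 5 + Polynomial.C (d 1 + l.1) * Polynomial.X ^ 4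
    + Polynomial.C g₁ * Polynomial.X ^ 3 + Polynomial.C (d 2 + l.2) * Polynomial.X ^ 2
    + Polynomial.C g₂ * Polynomial.X + Polynomial.C (d 3)
  have hΨ : ∀ t, Ψ.eval t * Ψ.eval (-t) = ∏ i, (v i ^ 2 - u i ^ 2 * t ^ 2) := by
    intro t
    rw [show ∏ i, (v i ^ 2 - u i ^ 2 * t ^ 2) = ∏ i, (u i ^ 2 * t ^ 2 - v i ^ 2 * 1) by
      simp only [Fin.prod_univ_six]; ring, ← hf]
    have := hg (t ^ 2) 1
    simp only [Ψ, Polynomial.eval_add, Polynomial.eval_mul, Polynomial.eval_C, Polynomial.eval_pow,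
      Polynomial.eval_X]
    simp only [branchForm]
    simp only [nodalForm] at this
    linear_combination t ^ 2 * this
  -- every choice of signs can be corrected one sign at a time
  have hflip : ∀ (ε : Fin 6 → ℤˣ) (j : Fin 6), ∏ i, Function.update ε j (-ε j) i = -∏ i, ε i := by
    intro ε j
    rw [Finset.prod_update_of_mem (Finset.mem_univ j), Finset.sdiff_singleton_eq_erase, neg_mul,
      Finset.mul_prod_erase _ _ (Finset.mem_univ j)]
  have hflip_u : ∀ (ε : Fin 6 → ℤˣ) (j : Fin 6), u j = 0 →
      signPoly u v (Function.update ε j (-ε j)) = -signPoly u v ε := by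
    intro ε j hj
    rw [signPoly, signPoly, ← Finset.mul_prod_erase _ _ (Finset.mem_univ j),
      ← Finset.mul_prod_erase _ _ (Finset.mem_univ j), ← neg_mul]
    congr 1
    · simp [hj]
    · refine Finset.prod_congr rfl fun k hk => ?_
      rw [Function.update_of_ne (Finset.ne_of_mem_erase hk)]
  have hflip_v : ∀ (ε : Fin 6 → ℤˣ) (j : Fin 6), v j = 0 →
      signPoly u v (Function.update ε j (-ε j)) = signPoly u v ε := by
    intro ε j hj
    refine Finset.prod_congr rfl fun k _ => ?_
    by_cases hk : k = j
    · simp [hk, hj]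
    · rw [Function.update_of_ne hk]
  obtain ⟨ε, hε⟩ : ∃ ε, Ψ = signPoly u v ε := by
    obtain ⟨κ, ε, hκ⟩ := exists_eq_prod_of_eval_mul_eval_neg u v Finset.univ hΨ
    rw [← signPoly] at hκ
    rcases Int.units_eq_one_or κ with rfl | rfl
    · exact ⟨ε, by simpa using hκ⟩
    · have h6 := congrArg (fun p => Polynomial.coeff p 6) hκ
      simp [-map_add, Ψ, signPoly_coeff_six, hu, Polynomial.coeff_X_pow] at h6
      have h0 : ∏ i, u i = 0 := by
        rw [hu]
        linear_combination h6 / 2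
      obtain ⟨j, -, hj⟩ := Finset.prod_eq_zero_iff.1 h0
      exact ⟨_, by rw [hflip_u ε j hj]; simpa using hκ⟩
  obtain ⟨ε, hε, hprod⟩ : ∃ ε, Ψ = signPoly u v ε ∧ ∏ i, ε i = 1 := by
    rcases Int.units_eq_one_or (∏ i, ε i) with h | h
    · exact ⟨ε, hε, h⟩
    · have h0 := congrArg (fun p => Polynomial.coeff p 0) hε
      simp [Ψ, signPoly_coeff_zero, hv, h] at h0
      have h0 : ∏ i, v i = 0 := by
        rw [hv]
        linear_combination h0 / 2
      obtain ⟨j, -, hj⟩ := Finset.prod_eq_zero_iff.1 h0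
      exact ⟨_, hε.trans (hflip_v ε j hj).symm, by rw [hflip, h, neg_neg]⟩
  have hslopes : signSlopes d u v ε = l := by
    rw [signSlopes, ← hε]
    ext <;> simp [-map_add, Ψ, Polynomial.coeff_X_pow]
  rcases Int.units_eq_one_or (ε 0) with h | h
  · exact ⟨ε, ⟨h, hprod⟩, hslopes⟩
  · refine ⟨-ε, ⟨by simp [h], ?_⟩, ?_⟩
    · rw [prod_neg_signs, hprod]
    · have hcomp : signPoly u v (-ε) = 
          (signPoly u v ε).comp (Polynomial.C (-1) * Polynomial.X) :=
        Polynomial.funext fun t => by simp [signPoly_eval_neg]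
      rw [← hslopes, signSlopes, signSlopes, hcomp, Polynomial.comp_C_mul_X_coeff,
        Polynomial.comp_C_mul_X_coeff]
      norm_num

theorem ncard_squareLines (hu : ∏ i, u i = d 0) (hv : ∏ i, v i = d 3)
    (hf : ∀ x y, branchForm d e x y = ∏ i, (u i ^ 2 * x - v i ^ 2 * y)) (hc : CrossNe u v) :
    (squareLines d e).ncard = 16 := by
  rw [← ncard_normalizedSigns, ← (injOn_signSlopes (d := d) hc).ncard_image]
  congr 1
  ext l
  constructor
  · intro hl
    exact exists_signSlopes_eq hu hv hf hl
  · rintro ⟨ε, hε, rfl⟩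
    exact signSlopes_mem_squareLines hu hv hf hc hε.2

end

/-! ### Lines in the frame of the node -/

lemma thetaLineOfType_iff {F : MvPolynomial (Fin 3) ℂ} {i : ℕ} {S : Set P2} :
    ThetaLineOfType F i S ↔ IsLine S ∧ (¬ S ⊆ curve F ∧ EverywhereTangent F S) ∧
      {p | p ∈ S ∧ IsSingularAt F p}.ncard = i := by
  unfold ThetaLineOfType ThetaLine
  tauto

/-- Number of singular points on a line when there is only one singular point. -/
lemma ncard_singular_of_iff {F : MvPolynomial (Fin 3) ℂ} {p : P2}
    (hp : ∀ q, IsSingularAt F q ↔ q = p) (S : Set P2) [Decidable (p ∈ S)] :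
    {q | q ∈ S ∧ IsSingularAt F q}.ncard = if p ∈ S then 1 else 0 := by
  split_ifs with h
  · rw [Set.ncard_eq_one]
    exact ⟨p, by ext q; simp only [hp, Set.mem_ofPred_eq, Set.mem_singleton_iff]; aesop⟩
  · rw [show {q | q ∈ S ∧ IsSingularAt F q} = ∅ by
      ext q; simp only [hp, Set.mem_ofPred_eq, Set.mem_empty_iff_false]; aesop, Set.ncard_empty]

/-- Prescribing the squares and the product of two complex numbers. -/
lemma exists_sq_eq_mul_eq {α β γ : ℂ} (h : β ^ 2 = α * γ) :
    ∃ g g' : ℂ, g ^ 2 = α ∧ g * g' = β ∧ g' ^ 2 = γ := by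
  by_cases hα : α = 0
  · obtain ⟨g', hg'⟩ := IsAlgClosed.exists_pow_nat_eq γ (n := 2) (by norm_num)
    have hβ : β = 0 := by simpa [hα] using h
    exact ⟨0, g', by simp [hα], by simp [hβ], hg'⟩
  · obtain ⟨g, hg⟩ := IsAlgClosed.exists_pow_nat_eq α (n := 2) (by norm_num)
    have hg0 : g ≠ 0 := by
      rintro rfl
      simp at hg
      exact hα hg.symm
    refine ⟨g, β / g, hg, mul_div_cancel₀ _ hg0, ?_⟩
    rw [div_pow, h, hg, mul_div_cancel_left₀ _ hα]

section

variable {a b₁ b₂ : Fin 3 → ℂ}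

lemma linearIndependent_slopes (hli : LinearIndependent ℂ ![a, b₁, b₂]) (l : ℂ × ℂ) :
    LinearIndependent ℂ ![l.1 • a + b₁, l.2 • a + b₂] := by
  refine linearIndependent_pair_iff.2 fun s t h => ?_
  exact (eq_zero_of_smul_add_eq_zero hli (z := s * l.1 + t * l.2) (by rw [← h]; module)).2

lemma linearIndependent_node (hli : LinearIndependent ℂ ![a, b₁, b₂]) {x y : ℂ}
    (hxy : ¬ (x = 0 ∧ y = 0)) : LinearIndependent ℂ ![a, x • b₁ + y • b₂] := by
  refine linearIndependent_pair_iff.2 fun s t h => ?_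
  obtain ⟨hs, hx, hy⟩ := eq_zero_of_smul_add_eq_zero hli (z := s) (x := t * x) (y := t * y)
    (by rw [← h]; module)
  exact ⟨hs, by_contra fun ht => hxy ⟨(mul_eq_zero.1 hx).resolve_left ht,
    (mul_eq_zero.1 hy).resolve_left ht⟩⟩

lemma isLine_and_notMem_iff (hli : LinearIndependent ℂ ![a, b₁, b₂]) (ha : a ≠ 0) {S : Set P2} :
    (IsLine S ∧ Projectivization.mk ℂ a ha ∉ S) ↔
      ∃ l : ℂ × ℂ, lineThrough (l.1 • a + b₁) (l.2 • a + b₂) = S := by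
  constructor
  · rintro ⟨⟨U, V, hUV, rfl⟩, hS⟩
    obtain ⟨z₁, x₁, y₁, hU⟩ := exists_eq_smul_add hli U
    obtain ⟨z₂, x₂, y₂, hV⟩ := exists_eq_smul_add hli V
    rw [mk_mem_lineThrough] at hS
    have hnode : ∀ s t : ℂ, s * x₁ + t * x₂ = 0 → s * y₁ + t * y₂ = 0 → s = 0 ∧ t = 0 := by
      intro s t hx hy
      have hc : s • U + t • V = (s * z₁ + t * z₂) • a := by
        rw [hU, hV, show s • (z₁ • a + x₁ • b₁ + y₁ • b₂) + t • (z₂ • a + x₂ • b₁ + y₂ • b₂) =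
          (s * z₁ + t * z₂) • a + (s * x₁ + t * x₂) • b₁ + (s * y₁ + t * y₂) • b₂ by module, hx, hy]
        simp
      by_cases h0 : s * z₁ + t * z₂ = 0
      · exact linearIndependent_pair_iff.1 hUV s t (by rw [hc, h0, zero_smul])
      · refine absurd ⟨(s * z₁ + t * z₂)⁻¹ * s, (s * z₁ + t * z₂)⁻¹ * t, ?_⟩ hS
        rw [mul_smul, mul_smul, ← smul_add, hc, inv_smul_smul₀ h0]
    have hdet : x₁ * y₂ - x₂ * y₁ ≠ 0 := by
      intro hdet
      have hy := hnode y₂ (-y₁) (by linear_combination hdet) (by ring)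
      have hx := hnode x₂ (-x₁) (by ring) (by linear_combination -hdet)
      have := hnode 1 0 (by simpa using hx.2) (by simpa using hy.2)
      exact one_ne_zero this.1
    obtain ⟨l₁, l₂, h₁, h₂⟩ : ∃ l₁ l₂ : ℂ, x₁ * l₁ + y₁ * l₂ = z₁ ∧ x₂ * l₁ + y₂ * l₂ = z₂ := by
      obtain ⟨Δ, hΔ⟩ : ∃ Δ, Δ = x₁ * y₂ - x₂ * y₁ := ⟨_, rfl⟩
      rw [← hΔ] at hdet
      refine ⟨(y₂ * z₁ - y₁ * z₂) / Δ, (x₁ * z₂ - x₂ * z₁) / Δ, ?_, ?_⟩ <;> field_simp <;>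
        rw [hΔ] <;> ring
    refine ⟨(l₁, l₂), (lineThrough_eq (α := x₁) (β := y₁) (γ := x₂) (δ := y₂) ?_ ?_ ?_).symm⟩
    · rw [hU, ← h₁]
      module
    · rw [hV, ← h₂]
      module
    · rwa [mul_comm y₁]
  · rintro ⟨l, rfl⟩
    refine ⟨⟨_, _, linearIndependent_slopes hli l, rfl⟩, fun h => ?_⟩
    obtain ⟨s, t, hst⟩ := (mk_mem_lineThrough ha).1 h
    obtain ⟨h1, h2, h3⟩ := eq_zero_of_smul_add_eq_zero hli (z := s * l.1 + t * l.2 - 1) (x := s)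
      (y := t) (by rw [← sub_eq_zero.2 hst.symm]; module)
    simp [h2, h3] at h1

lemma isLine_and_mem_iff (hli : LinearIndependent ℂ ![a, b₁, b₂]) (ha : a ≠ 0) {S : Set P2} :
    (IsLine S ∧ Projectivization.mk ℂ a ha ∈ S) ↔
      ∃ x y : ℂ, ¬ (x = 0 ∧ y = 0) ∧ lineThrough a (x • b₁ + y • b₂) = S := by
  constructor
  · rintro ⟨⟨U, V, hUV, rfl⟩, hS⟩
    obtain ⟨s, t, hst⟩ := (mk_mem_lineThrough ha).1 hS
    obtain ⟨W, γ, δ, hW, hdet⟩ : ∃ (W : Fin 3 → ℂ) (γ δ : ℂ),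
        W = γ • U + δ • V ∧ s * δ - t * γ ≠ 0 := by
      by_cases hs : s = 0
      · refine ⟨U, 1, 0, by simp, fun h => ha ?_⟩
        rw [hst, hs, show t = 0 by linear_combination -h]
        simp
      · exact ⟨V, 0, 1, by simp, by simpa using hs⟩
    obtain ⟨z, x, y, hzxy⟩ := exists_eq_smul_add hli W
    have haW := linearIndependent_pair_of_det hUV hst hW hdet
    refine ⟨x, y, ?_, ?_⟩
    · rintro ⟨rfl, rfl⟩
      have := linearIndependent_pair_iff.1 haW z (-1) (by rw [hzxy]; module)
      simp at this
    · rw [← lineThrough_eq hst hW hdet]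
      exact lineThrough_eq (α := 1) (β := 0) (γ := -z) (δ := 1) (by module)
        (by rw [hzxy]; module) (by norm_num)
  · rintro ⟨x, y, hxy, rfl⟩
    exact ⟨⟨_, _, linearIndependent_node hli hxy, rfl⟩,
      (mk_mem_lineThrough ha).2 ⟨1, 0, by module⟩⟩

lemma lineThrough_slopes_injective (hli : LinearIndependent ℂ ![a, b₁, b₂]) :
    Function.Injective fun l : ℂ × ℂ => lineThrough (l.1 • a + b₁) (l.2 • a + b₂) := by
  intro l l' h
  have key : ∀ w : Fin 3 → ℂ, w ≠ 0 → (∃ s t : ℂ, w = s • (l.1 • a + b₁) + t • (l.2 • a + b₂)) →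
      ∃ s t : ℂ, w = s • (l'.1 • a + b₁) + t • (l'.2 • a + b₂) := fun w hw hw' => by
    rw [← mk_mem_lineThrough hw] at hw' ⊢
    exact (show lineThrough _ _ = lineThrough _ _ from h) ▸ hw'
  have hne := linearIndependent_slopes hli l
  obtain ⟨s, t, h1⟩ := key (l.1 • a + b₁) (hne.ne_zero 0) ⟨1, 0, by module⟩
  obtain ⟨s', t', h2⟩ := key (l.2 • a + b₂) (hne.ne_zero 1) ⟨0, 1, by module⟩
  obtain ⟨h3, h4, h5⟩ := eq_zero_of_smul_add_eq_zero hli (z := l.1 - (s * l'.1 + t * l'.2))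
    (x := 1 - s) (y := -t) (by rw [← sub_eq_zero.2 h1]; module)
  obtain ⟨h6, h7, h8⟩ := eq_zero_of_smul_add_eq_zero hli (z := l.2 - (s' * l'.1 + t' * l'.2))
    (x := -s') (y := 1 - t') (by rw [← sub_eq_zero.2 h2]; module)
  ext
  · linear_combination h3 - l'.1 * h4 - l'.2 * h5
  · linear_combination h6 - l'.1 * h7 - l'.2 * h8

end

namespace NodalFrame

variable {F : MvPolynomial (Fin 3) ℂ} {a b₁ b₂ : Fin 3 → ℂ} {d : Fin 4 → ℂ} {e : Fin 5 → ℂ}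

lemma tangent_slopes_iff (h : NodalFrame F a b₁ b₂ d e) (l : ℂ × ℂ) :
    (¬ lineThrough (l.1 • a + b₁) (l.2 • a + b₂) ⊆ curve F ∧
      EverywhereTangent F (lineThrough (l.1 • a + b₁) (l.2 • a + b₂))) ↔ l ∈ squareLines d e := by
  rw [everywhereTangent_iff_sq h.isHomogeneous (linearIndependent_slopes h.linearIndependent l)]
  have : ∀ x y : ℂ, eval (x • (l.1 • a + b₁) + y • (l.2 • a + b₂)) F =
      nodalForm d e (x * l.1 + y * l.2) x y := fun x y => by
    rw [← h.eval_eq]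
    congr 2
    module
  simp only [this, squareLines, Set.mem_ofPred_eq]

lemma tangent_node_iff (h : NodalFrame F a b₁ b₂ d e) {x y : ℂ} (hxy : ¬ (x = 0 ∧ y = 0)) :
    (¬ lineThrough a (x • b₁ + y • b₂) ⊆ curve F ∧
      EverywhereTangent F (lineThrough a (x • b₁ + y • b₂))) ↔ branchForm d e x y = 0 := by
  rw [everywhereTangent_iff_sq h.isHomogeneous (linearIndependent_node h.linearIndependent hxy)]
  set q := d 0 * x ^ 3 + d 1 * x ^ 2 * y + d 2 * x * y ^ 2 + d 3 * y ^ 3 with hq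
  set r := e 0 * x ^ 4 + e 1 * x ^ 3 * y + e 2 * x ^ 2 * y ^ 2 + e 3 * x * y ^ 3 + e 4 * y ^ 4
    with hr
  have heval : ∀ s t : ℂ, eval (s • a + t • (x • b₁ + y • b₂)) F =
      t ^ 2 * (x * y * s ^ 2 + 2 * q * s * t + r * t ^ 2) := fun s t => by
    rw [show s • a + t • (x • b₁ + y • b₂) = s • a + (t * x) • b₁ + (t * y) • b₂ by module,
      h.eval_eq, nodalForm, hq, hr]
    ring
  have hbranch : branchForm d e x y = q ^ 2 - x * y * r := rfl
  rw [hbranch]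
  constructor
  · rintro ⟨g₀, g₁, g₂, -, hg⟩
    simp only [heval] at hg
    have hg0 : g₀ = 0 := by simpa using (hg 1 0).symm
    subst hg0
    have e0 := hg 0 1
    have e1 := hg 1 1
    have e2 := hg (-1) 1
    have hr' : r = g₂ ^ 2 := by linear_combination e0
    have hxy' : x * y = g₁ ^ 2 := by linear_combination (e1 + e2) / 2 - e0
    have hq' : q = g₁ * g₂ := by linear_combination (e1 - e2) / 4
    rw [hr', hxy', hq']
    ring
  · intro h0
    obtain ⟨g₁, g₂, h1, h12, h2⟩ := exists_sq_eq_mul_eq (sub_eq_zero.1 h0)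
    refine ⟨0, g₁, g₂, ?_, fun s t => ?_⟩
    · rintro ⟨-, rfl, rfl⟩
      have hx : x = 0 ∨ y = 0 := by simpa using h1.symm
      rcases hx with rfl | rfl
      · have hy : y ≠ 0 := fun hy => hxy ⟨rfl, hy⟩
        refine h.not_d_three_e_four_eq_zero ⟨?_, ?_⟩
        · simpa [hq, hy] using h12.symm
        · simpa [hr, hy] using h2.symm
      · have hx : x ≠ 0 := fun hx => hxy ⟨hx, rfl⟩
        refine h.not_d_zero_e_zero_eq_zero ⟨?_, ?_⟩
        · simpa [hq, hx] using h12.symm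
        · simpa [hr, hx] using h2.symm
    · rw [heval, ← h1, ← h12, ← h2]
      ring

lemma ncard_tangent_node (h : NodalFrame F a b₁ b₂ d e) (ha : a ≠ 0) {u v : Fin 6 → ℂ}
    (hf : ∀ x y, branchForm d e x y = ∏ i, (u i ^ 2 * x - v i ^ 2 * y)) (hc : CrossNe u v) :
    {S : Set P2 | IsLine S ∧ (¬ S ⊆ curve F ∧ EverywhereTangent F S) ∧
      Projectivization.mk ℂ a ha ∈ S}.ncard = 6 := by
  have hli := h.linearIndependent
  have hne : ∀ i, ¬ (v i ^ 2 = 0 ∧ u i ^ 2 = 0) := by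
    rintro i ⟨hv, hu⟩
    obtain ⟨j, hj⟩ := exists_ne i
    exact hc i j hj.symm (by rw [hu, hv]; ring)
  let ψ : Fin 6 → Set P2 := fun i => lineThrough a (v i ^ 2 • b₁ + u i ^ 2 • b₂)
  have hψ : Function.Injective ψ := by
    intro i j hij
    by_contra hne'
    have hw : v i ^ 2 • b₁ + u i ^ 2 • b₂ ≠ 0 :=
      (linearIndependent_node hli (hne i)).ne_zero 1
    have hmem : Projectivization.mk ℂ _ hw ∈ ψ j := by
      rw [← hij]
      exact (mk_mem_lineThrough hw).2 ⟨0, 1, by module⟩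
    obtain ⟨s, t, hst⟩ := (mk_mem_lineThrough hw).1 hmem
    obtain ⟨-, h1, h2⟩ := eq_zero_of_smul_add_eq_zero hli (z := -s) (x := v i ^ 2 - t * v j ^ 2)
      (y := u i ^ 2 - t * u j ^ 2) (by rw [← sub_eq_zero.2 hst]; module)
    exact hc i j hne' (by linear_combination v j ^ 2 * h2 - u j ^ 2 * h1)
  have hrange : {S : Set P2 | IsLine S ∧ (¬ S ⊆ curve F ∧ EverywhereTangent F S) ∧
      Projectivization.mk ℂ a ha ∈ S} = Set.range ψ := by
    ext S
    constructor
    · rintro ⟨hS, htan, hmem⟩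
      obtain ⟨x, y, hxy, rfl⟩ := (isLine_and_mem_iff hli ha).1 ⟨hS, hmem⟩
      rw [h.tangent_node_iff hxy, hf, Finset.prod_eq_zero_iff] at htan
      obtain ⟨i, -, hi⟩ := htan
      obtain ⟨c, hc0, hx, hy⟩ : ∃ c : ℂ, c ≠ 0 ∧ v i ^ 2 = c * x ∧ u i ^ 2 = c * y := by
        by_cases hx0 : x = 0
        · have hy0 : y ≠ 0 := fun hy0 => hxy ⟨hx0, hy0⟩
          have hv0 : v i ^ 2 = 0 := by simpa [hx0, hy0] using hi
          refine ⟨u i ^ 2 / y, div_ne_zero (fun hu0 => hne i ⟨hv0, hu0⟩) hy0, ?_, ?_⟩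
          · rw [hv0, hx0, mul_zero]
          · field_simp
        · refine ⟨v i ^ 2 / x, div_ne_zero (fun hv0 => hne i ⟨hv0, ?_⟩) hx0, ?_, ?_⟩
          · simpa [hv0, hx0] using hi
          · field_simp
          · field_simp
            linear_combination hi
      refine ⟨i, lineThrough_eq (α := 1) (β := 0) (γ := 0) (δ := c) (by module) ?_ (by simpa)⟩
      rw [hx, hy]
      module
    · rintro ⟨i, rfl⟩
      obtain ⟨hS, hmem⟩ := (isLine_and_mem_iff hli ha).2 ⟨_, _, hne i, rfl⟩
      refine ⟨hS, (h.tangent_node_iff (hne i)).2 ?_, hmem⟩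
      rw [hf]
      exact Finset.prod_eq_zero (Finset.mem_univ i) (by ring)
  rw [hrange, ← Set.image_univ, Set.ncard_image_of_injective _ hψ, Set.ncard_univ]
  simp

lemma ncard_tangent_slopes (h : NodalFrame F a b₁ b₂ d e) (ha : a ≠ 0) {u v : Fin 6 → ℂ}
    (hu : ∏ i, u i = d 0) (hv : ∏ i, v i = d 3)
    (hf : ∀ x y, branchForm d e x y = ∏ i, (u i ^ 2 * x - v i ^ 2 * y)) (hc : CrossNe u v) :
    {S : Set P2 | IsLine S ∧ (¬ S ⊆ curve F ∧ EverywhereTangent F S) ∧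
      Projectivization.mk ℂ a ha ∉ S}.ncard = 16 := by
  rw [← ncard_squareLines hu hv hf hc, ← Set.ncard_image_of_injective (squareLines d e)
    (lineThrough_slopes_injective h.linearIndependent)]
  congr 1
  ext S
  constructor
  · rintro ⟨hS, htan, hmem⟩
    obtain ⟨l, rfl⟩ := (isLine_and_notMem_iff h.linearIndependent ha).1 ⟨hS, hmem⟩
    exact ⟨l, (h.tangent_slopes_iff l).1 htan, rfl⟩
  · rintro ⟨l, hl, rfl⟩
    obtain ⟨hS, hmem⟩ := (isLine_and_notMem_iff h.linearIndependent ha).2 ⟨l, rfl⟩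
    exact ⟨hS, (h.tangent_slopes_iff l).2 hl, hmem⟩

end NodalFrame

/-- An irreducible plane quartic whose only singularity is one ordinary
node has exactly 16 theta-lines of type 0 (bitangents), exactly 6 theta-lines of type 1
(all passing through the node), and no theta-lines of type 2. -/
theorem uninodal_quartic_theta_lines
    (F : MvPolynomial (Fin 3) ℂ) (hF4 : F.IsHomogeneous 4) (hirr : Irreducible F)
    (p : P2) (hp : OrdinaryNode F p)
    (honly : ∀ q : P2, IsSingularAt F q → q = p) :
    {S : Set P2 | ThetaLineOfType F 0 S}.ncard = 16 ∧
    {S : Set P2 | ThetaLineOfType F 1 S}.ncard = 6 ∧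
    (∀ S : Set P2, ThetaLineOfType F 1 S → p ∈ S) ∧
    {S : Set P2 | ThetaLineOfType F 2 S} = ∅ := by
  classical
  obtain ⟨a, b₁, b₂, ha, d, e, rfl, hli, heval⟩ := exists_nodalForm hF4 hp
  have hframe : NodalFrame F a b₁ b₂ d e :=
    ⟨hF4, hli, heval, fun w hw hs => (mk_eq_iff_smul ha hw).1 (honly _ hs)⟩
  have hsing : ∀ q, IsSingularAt F q ↔ q = Projectivization.mk ℂ a ha :=
    fun q => ⟨honly q, fun hq => hq ▸ hp.1.1⟩
  obtain ⟨u, v, hu, hv, hf⟩ := exists_branchForm_eq_prod d e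
  have hc : CrossNe u v := fun i j hij => hframe.cross_ne hf hij
  simp only [thetaLineOfType_iff, ncard_singular_of_iff hsing]
  refine ⟨?_, ?_, fun S hS => ?_, ?_⟩
  · rw [← hframe.ncard_tangent_slopes ha hu hv hf hc]
    congr! 6
    simp
  · rw [← hframe.ncard_tangent_node ha hf hc]
    congr! 6
    simp
  · by_contra hmem
    simp [hmem] at hS
  · refine Set.eq_empty_iff_forall_notMem.2 fun S hS => ?_
    have := hS.2.2
    split_ifs at this
    omega

end
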